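/- Let r ≥ 2 be an integer and let F be a graph satisfying Hypothesis (★). Then for all sufficiently large n the following holds: if G is an F-free graph on n vertices such that λ(G) ≥ λ(G') for every F-free graph G' on n vertices, then e(G) = ex(n,F); consequently G ∈ Ex(n,F), i.e., G is obtained from the Turán graph T_{n,r} by adding a edges. -/

import Mathlib

open SimpleGraph

/-- The adjacency matrix of a simple graph over `ℝ`. -/
noncomputable def adjMat {V : Type*} [Fintype V] (G : SimpleGraph V) : Matrix V V ℝ :=
  letI := Classical.decRel G.Adj
  G.adjMatrix ℝ

/-- The spectral radius of a simple graph: the largest eigenvalue of its adjacency matrix. -/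
noncomputable def specRad {V : Type*} [Fintype V] [DecidableEq V] (G : SimpleGraph V) : ℝ :=
  sSup (spectrum ℝ (adjMat G))

/-- The number of edges of a simple graph. -/
noncomputable def eCnt {V : Type*} (G : SimpleGraph V) : ℕ := Nat.card G.edgeSet

/-- `G` contains a copy of `F` (a subgraph isomorphic to `F`). -/
def Contains {W V : Type*} (F : SimpleGraph W) (G : SimpleGraph V) : Prop :=
  ∃ f : F →g G, Function.Injective f

/-- `G` is `F`-free. -/
def FFree {W V : Type*} (F : SimpleGraph W) (G : SimpleGraph V) : Prop := ¬ Contains F G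

/-- The Turán number `ex(n, F)`. -/
noncomputable def exNum {W : Type*} (n : ℕ) (F : SimpleGraph W) : ℕ :=
  sSup {m | ∃ G : SimpleGraph (Fin n), FFree F G ∧ eCnt G = m}

/-- `G` is obtained from the Turán graph `T_{n,r}` by adding `a` edges. -/
def TuranPlus (n r a : ℕ) (G : SimpleGraph (Fin n)) : Prop :=
  (∃ H : SimpleGraph (Fin n), H ≤ G ∧ Nonempty (H ≃g turanGraph n r)) ∧
    eCnt G = eCnt (turanGraph n r) + a

/-- Hypothesis (★): for all sufficiently large `m`, `ex(m,F) = e(T_{m,r}) + a` and every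
extremal graph is obtained from `T_{m,r}` by adding `a` edges. -/
def HypStar {W : Type*} (r a : ℕ) (F : SimpleGraph W) : Prop :=
  ∃ m₀ : ℕ, ∀ m ≥ m₀,
    exNum m F = eCnt (turanGraph m r) + a ∧
    ∀ G : SimpleGraph (Fin m), FFree F G → eCnt G = exNum m F → TuranPlus m r a G

/-- `G` is a spectral-extremal `F`-free graph on its vertex set. -/
def SpecExtremal {W : Type*} (F : SimpleGraph W) {n : ℕ} (G : SimpleGraph (Fin n)) : Prop :=
  FFree F G ∧ ∀ G' : SimpleGraph (Fin n), FFree F G' → specRad G' ≤ specRad G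

section spectral

variable {V : Type*} [Fintype V]

open scoped Classical in
lemma adjMat_apply (G : SimpleGraph V) (u v : V) :
    adjMat G u v = if G.Adj u v then 1 else 0 := by
  simp [adjMat, adjMatrix_apply]

lemma adjMat_of_adj {G : SimpleGraph V} {u v : V} (h : G.Adj u v) : adjMat G u v = 1 := by
  rw [adjMat_apply, if_pos h]

lemma adjMat_of_not_adj {G : SimpleGraph V} {u v : V} (h : ¬ G.Adj u v) : adjMat G u v = 0 := by
  rw [adjMat_apply, if_neg h]

lemma adjMat_symm (G : SimpleGraph V) (u v : V) : adjMat G u v = adjMat G v u := by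
  by_cases h : G.Adj u v
  · rw [adjMat_of_adj h, adjMat_of_adj h.symm]
  · rw [adjMat_of_not_adj h, adjMat_of_not_adj fun h' => h h'.symm]

lemma adjMat_nonneg (G : SimpleGraph V) (u v : V) : 0 ≤ adjMat G u v := by
  rw [adjMat_apply]; split_ifs <;> norm_num

lemma adjMat_le_one (G : SimpleGraph V) (u v : V) : adjMat G u v ≤ 1 := by
  rw [adjMat_apply]; split_ifs <;> norm_num

lemma sum_adjMat (G : SimpleGraph V) : ∑ u, ∑ v, adjMat G u v = 2 * (eCnt G : ℝ) := by
  classical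
  have h := G.sum_degrees_eq_twice_card_edges
  have h2 : eCnt G = G.edgeFinset.card := by
    rw [eCnt, Nat.card_eq_fintype_card, edgeFinset_card]
  rw [h2]
  have h3 : ∀ u, ∑ v, adjMat G u v = (G.degree u : ℝ) := by
    intro u
    simp only [adjMat_apply, Finset.sum_boole, ← card_neighborFinset_eq_degree]
    congr 2
    ext v; simp
  simp only [h3]
  exact_mod_cast h

/-- `l` is the maximum of the Rayleigh quotient of the adjacency matrix of `G`, attained at a
nonnegative eigenvector. -/
def IsPerron (G : SimpleGraph V) (l : ℝ) : Prop :=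
  (∃ x : V → ℝ, (∀ v, 0 ≤ x v) ∧ 0 < ∑ v, x v ∧ ∀ v, ∑ u, adjMat G v u * x u = l * x v) ∧
    ∀ y : V → ℝ, ∑ v, ∑ u, adjMat G v u * (y v * y u) ≤ l * ∑ v, y v ^ 2

lemma exists_maximizer [Nonempty V] (G : SimpleGraph V) :
    ∃ x : V → ℝ, ∑ v, x v ^ 2 = 1 ∧ ∀ y : V → ℝ, ∑ v, y v ^ 2 = 1 →
      ∑ v, ∑ u, adjMat G v u * (y v * y u) ≤ ∑ v, ∑ u, adjMat G v u * (x v * x u) := by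
  classical
  have hc : IsCompact {x : V → ℝ | ∑ v, x v ^ 2 = 1} := by
    refine Metric.isCompact_of_isClosed_isBounded (isClosed_eq (by fun_prop) continuous_const) ?_
    refine (Metric.isBounded_iff_subset_closedBall 0).2 ⟨1, fun x hx => ?_⟩
    rw [mem_closedBall_zero_iff, pi_norm_le_iff_of_nonneg zero_le_one]
    intro v
    have h1 : x v ^ 2 ≤ 1 := by
      rw [← show ∑ v, x v ^ 2 = 1 from hx]
      exact Finset.single_le_sum (f := fun v => x v ^ 2) (fun _ _ => sq_nonneg _)
        (Finset.mem_univ v)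
    rw [Real.norm_eq_abs]
    exact (sq_le_one_iff_abs_le_one _).1 h1
  obtain ⟨w⟩ := ‹Nonempty V›
  obtain ⟨x, hx, hmax⟩ := hc.exists_isMaxOn
    (f := fun x : V → ℝ => ∑ v, ∑ u, adjMat G v u * (x v * x u))
    ⟨Pi.single w 1, by simp [Pi.single_apply, Finset.sum_ite_eq']⟩ (by fun_prop)
  exact ⟨x, hx, fun y hy => hmax hy⟩

lemma isPerron_specRad [DecidableEq V] [Nonempty V] (G : SimpleGraph V) :
    IsPerron G (specRad G) := by
  obtain ⟨y, hy, hmax⟩ := exists_maximizer G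
  set q : (V → ℝ) → ℝ := fun y => ∑ v, ∑ u, adjMat G v u * (y v * y u) with hq
  set m := q y with hm
  have hray : ∀ z : V → ℝ, q z ≤ m * ∑ v, z v ^ 2 := by
    intro z
    rcases (Finset.sum_nonneg fun v _ => sq_nonneg (z v) : 0 ≤ ∑ v, z v ^ 2).eq_or_lt with h0 | h0
    · have hz : ∀ v, z v = 0 := by
        intro v
        have := (Finset.sum_eq_zero_iff_of_nonneg (fun v _ => sq_nonneg (z v))).1 h0.symm v
          (Finset.mem_univ v)
        exact pow_eq_zero_iff (two_ne_zero) |>.1 this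
      simp [hq, hz]
    · set N := ∑ v, z v ^ 2 with hN
      have hs : Real.sqrt N ≠ 0 := (Real.sqrt_pos.2 h0).ne'
      have h1 := hmax (fun v => z v / Real.sqrt N) (by
        simp only [div_pow, Real.sq_sqrt h0.le]
        rw [← Finset.sum_div, ← hN, div_self h0.ne'])
      have h2 : ∑ v, ∑ u, adjMat G v u * (z v / Real.sqrt N * (z u / Real.sqrt N)) = q z / N := by
        simp only [hq, Finset.sum_div]
        refine Finset.sum_congr rfl fun v _ => Finset.sum_congr rfl fun u _ => ?_
        conv_rhs => rw [← Real.mul_self_sqrt h0.le]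
        field_simp
      rw [h2, div_le_iff₀ h0] at h1
      exact h1
  set x : V → ℝ := fun v => |y v| with hx
  have hxn : ∑ v, x v ^ 2 = 1 := by simpa [hx, sq_abs] using hy
  have hqx : q x = m := by
    refine le_antisymm (hmax x hxn) ?_
    refine Finset.sum_le_sum fun v _ => Finset.sum_le_sum fun u _ => ?_
    refine mul_le_mul_of_nonneg_left ?_ (adjMat_nonneg G v u)
    rw [hx, ← abs_mul]
    exact le_abs_self _
  have hform : ∀ z : V → ℝ, z ⬝ᵥ (adjMat G).mulVec z = q z := by
    intro z
    simp only [dotProduct, Matrix.mulVec, hq, Finset.mul_sum]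
    exact Finset.sum_congr rfl fun v _ => Finset.sum_congr rfl fun u _ => by ring
  have hform2 : ∀ z : V → ℝ, z ⬝ᵥ (m • (1 : Matrix V V ℝ) - adjMat G).mulVec z
      = m * ∑ v, z v ^ 2 - q z := by
    intro z
    rw [Matrix.sub_mulVec, dotProduct_sub, hform, Matrix.smul_mulVec, Matrix.one_mulVec,
      dotProduct_smul, smul_eq_mul]
    simp [dotProduct, sq]
  have hpsd : (m • (1 : Matrix V V ℝ) - adjMat G).PosSemidef := by
    refine Matrix.PosSemidef.of_dotProduct_mulVec_nonneg ?_ fun z => ?_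
    · ext u v
      simp [Matrix.one_apply, adjMat_symm G u v, eq_comm]
    · rw [star_trivial, hform2]
      linarith [hray z]
  have heig0 : (m • (1 : Matrix V V ℝ) - adjMat G).mulVec x = 0 := by
    rw [← hpsd.dotProduct_mulVec_zero_iff, star_trivial, hform2, hxn, hqx]
    ring
  have heig : (adjMat G).mulVec x = m • x := by
    rw [Matrix.sub_mulVec, Matrix.smul_mulVec, Matrix.one_mulVec, sub_eq_zero] at heig0
    exact heig0.symm
  have hspec : specRad G = m := by
    have hgr : IsGreatest (spectrum ℝ (adjMat G)) m := by
      rw [← Matrix.spectrum_toLin']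
      constructor
      · rw [← Module.End.hasEigenvalue_iff_mem_spectrum]
        refine Module.End.hasEigenvalue_of_hasEigenvector (x := x)
          ⟨Module.End.mem_eigenspace_iff.2 (by rw [Matrix.toLin'_apply, heig]), ?_⟩
        intro h0
        simp [h0] at hxn
      · intro c hc
        rw [← Module.End.hasEigenvalue_iff_mem_spectrum] at hc
        obtain ⟨w, hw⟩ := hc.exists_hasEigenvector
        have h1 := hw.apply_eq_smul
        rw [Matrix.toLin'_apply] at h1
        have h2 : q w = c * ∑ v, w v ^ 2 := by
          rw [← hform, h1, dotProduct_smul, smul_eq_mul]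
          simp [dotProduct, sq]
        have h3 : 0 < ∑ v, w v ^ 2 := by
          obtain ⟨v, hv⟩ := Function.ne_iff.1 hw.2
          exact Finset.sum_pos' (fun _ _ => sq_nonneg _)
            ⟨v, Finset.mem_univ v, by have : w v ≠ 0 := hv; positivity⟩
        have h4 := hray w
        rw [h2] at h4
        exact le_of_mul_le_mul_right h4 h3
    exact hgr.csSup_eq
  rw [hspec]
  refine ⟨⟨x, fun v => abs_nonneg _, ?_, fun v => congrFun heig v⟩, hray⟩
  refine lt_of_le_of_ne (Finset.sum_nonneg fun v _ => abs_nonneg _) fun h0 => ?_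
  have : ∀ v, x v = 0 := fun v =>
    (Finset.sum_eq_zero_iff_of_nonneg (fun v _ => abs_nonneg (y v))).1 h0.symm v (Finset.mem_univ v)
  simp [this] at hxn

end spectral

section counting

/-- The number of vertices with colour `i`. -/
def clsCard {V : Type*} [Fintype V] {r : ℕ} (c : V → Fin r) (i : Fin r) : ℕ :=
  (Finset.univ.filter fun v => c v = i).card

/-- Indicator of a (directed) edge inside a colour class. -/
noncomputable def inEdge {V : Type*} [Fintype V] {r : ℕ} (G : SimpleGraph V) (c : V → Fin r)
    (u v : V) : ℝ :=
  if c u = c v then adjMat G u v else 0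

/-- Indicator of a (directed) non-edge between different colour classes. -/
noncomputable def misEdge {V : Type*} [Fintype V] {r : ℕ} (G : SimpleGraph V) (c : V → Fin r)
    (u v : V) : ℝ :=
  if c u = c v then 0 else 1 - adjMat G u v

/-- The colour classes are as equal in size as possible. -/
def EquiColoring {n r : ℕ} (c : Fin n → Fin r) : Prop :=
  ∀ i, clsCard c i = n / r ∨ clsCard c i = n / r + 1

section general

variable {V : Type*} [Fintype V] {r : ℕ}

lemma inEdge_nonneg (G : SimpleGraph V) (c : V → Fin r) (u v : V) : 0 ≤ inEdge G c u v := by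
  unfold inEdge; split_ifs; exacts [adjMat_nonneg _ _ _, le_rfl]

lemma misEdge_nonneg (G : SimpleGraph V) (c : V → Fin r) (u v : V) : 0 ≤ misEdge G c u v := by
  unfold misEdge; split_ifs; exacts [le_rfl, sub_nonneg.2 (adjMat_le_one _ _ _)]

lemma inEdge_symm (G : SimpleGraph V) (c : V → Fin r) (u v : V) :
    inEdge G c u v = inEdge G c v u := by
  simp only [inEdge, adjMat_symm G u v, eq_comm (a := c u)]

lemma misEdge_symm (G : SimpleGraph V) (c : V → Fin r) (u v : V) :
    misEdge G c u v = misEdge G c v u := by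
  simp only [misEdge, adjMat_symm G u v, eq_comm (a := c u)]

lemma adjMat_eq (G : SimpleGraph V) (c : V → Fin r) (u v : V) :
    adjMat G u v = (1 - if c u = c v then 1 else 0) + inEdge G c u v - misEdge G c u v := by
  unfold inEdge misEdge; split_ifs <;> ring

lemma sum_clsCard (c : V → Fin r) : ∑ i, clsCard c i = Fintype.card V := by
  rw [← Finset.card_univ]
  exact (Finset.card_eq_sum_card_fiberwise (f := c) (t := Finset.univ) (fun _ _ => by simp)).symm

lemma sum_same (c : V → Fin r) (x y : V → ℝ) :
    ∑ u, ∑ v, (if c u = c v then x u * y v else 0)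
      = ∑ i, (∑ v, if c v = i then x v else 0) * (∑ v, if c v = i then y v else 0) := by
  have : ∀ u v, (if c u = c v then x u * y v else 0)
      = ∑ i, (if c u = i then x u else 0) * (if c v = i then y v else 0) := by
    intro u v
    rw [Finset.sum_eq_single (c u)]
    · simp [eq_comm]
    · intro i _ hi
      simp [hi.symm]
    · simp
  simp only [this]
  simp_rw [Finset.sum_mul_sum]
  rw [Finset.sum_congr rfl fun u _ => Finset.sum_comm, Finset.sum_comm]

lemma two_mul_eCnt (G : SimpleGraph V) (c : V → Fin r) :
    2 * (eCnt G : ℝ) = (Fintype.card V : ℝ) ^ 2 - ∑ i, (clsCard c i : ℝ) ^ 2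
      + ∑ u, ∑ v, inEdge G c u v - ∑ u, ∑ v, misEdge G c u v := by
  have h1 := sum_same c (fun _ => 1) (fun _ => 1)
  rw [← sum_adjMat]
  simp only [adjMat_eq G c, Finset.sum_add_distrib, Finset.sum_sub_distrib]
  simp only [mul_one] at h1
  rw [h1]
  simp [clsCard, sq]

end general

variable {n r : ℕ}

lemma EquiColoring.sum_sq {c : Fin n → Fin r} (hc : EquiColoring c) :
    ∑ i, (clsCard c i : ℝ) ^ 2
      = r * ((n / r : ℕ) : ℝ) ^ 2 + (n - r * ((n / r : ℕ) : ℝ)) * (2 * ((n / r : ℕ) : ℝ) + 1) := by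
  set q := n / r
  have h : ∀ i, (clsCard c i : ℝ) ^ 2 = (q : ℝ) ^ 2 + ((clsCard c i : ℝ) - q) * (2 * q + 1) := by
    intro i
    rcases hc i with h | h <;> rw [h] <;> push_cast <;> ring
  have h2 : ∑ i, (clsCard c i : ℝ) = n := by
    have := sum_clsCard c
    rw [Fintype.card_fin] at this
    exact_mod_cast this
  simp only [h, Finset.sum_add_distrib, ← Finset.sum_mul, Finset.sum_sub_distrib, h2]
  simp

/-- The colouring of the Turán graph by residues modulo `r`. -/
def modColor (n r : ℕ) (hr : 0 < r) (v : Fin n) : Fin r := ⟨v % r, Nat.mod_lt _ hr⟩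

lemma modColor_equi (n : ℕ) {r : ℕ} (hr : 0 < r) : EquiColoring (modColor n r hr) := by
  intro i
  have h : clsCard (modColor n r hr) i = n.count (· ≡ i [MOD r]) := by
    rw [Nat.count_eq_card_filter_range, clsCard]
    refine Finset.card_bij (fun v _ => (v : ℕ)) ?_ ?_ ?_
    · intro v hv
      have hv' : modColor n r hr v = i := by simpa using hv
      simp [Nat.ModEq, ← hv', modColor]
    · intro v _ w _ h
      exact Fin.ext h
    · intro b hb
      simp only [Finset.mem_filter, Finset.mem_range] at hb
      refine ⟨⟨b, hb.1⟩, Finset.mem_filter.2 ⟨Finset.mem_univ _, Fin.ext ?_⟩, rfl⟩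
      have := hb.2
      rw [Nat.ModEq, Nat.mod_eq_of_lt i.2] at this
      exact this
  rw [h, Nat.count_modEq_card _ hr]
  split_ifs <;> simp

lemma EquiColoring.two_mul_eCnt_turanGraph (hr : 0 < r) {c : Fin n → Fin r} (hc : EquiColoring c) :
    2 * (eCnt (turanGraph n r) : ℝ) = (n : ℝ) ^ 2 - ∑ i, (clsCard c i : ℝ) ^ 2 := by
  rw [two_mul_eCnt _ (modColor n r hr), hc.sum_sq, (modColor_equi n hr).sum_sq]
  have h1 : ∀ u v, inEdge (turanGraph n r) (modColor n r hr) u v = 0 := by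
    intro u v
    simp only [inEdge, modColor, adjMat_apply, turanGraph_adj, Fin.mk.injEq]
    split_ifs <;> simp_all
  have h2 : ∀ u v, misEdge (turanGraph n r) (modColor n r hr) u v = 0 := by
    intro u v
    simp only [misEdge, modColor, adjMat_apply, turanGraph_adj, Fin.mk.injEq]
    split_ifs <;> simp_all
  simp [h1, h2]

end counting

section extremal

variable {W : Type*} {F : SimpleGraph W}

lemma FFree.comap {n m : ℕ} {G : SimpleGraph (Fin n)} (h : FFree F G) {f : Fin m → Fin n}
    (hf : Function.Injective f) : FFree F (G.comap f) := by
  rintro ⟨g, hg⟩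
  exact h ⟨⟨fun w => f (g w), fun hab => g.map_adj hab⟩, hf.comp hg⟩

lemma finite_eCnt_set (n : ℕ) (F : SimpleGraph W) :
    {m | ∃ G : SimpleGraph (Fin n), FFree F G ∧ eCnt G = m}.Finite := by
  refine (Set.finite_range fun G : SimpleGraph (Fin n) => eCnt G).subset ?_
  rintro m ⟨G, -, rfl⟩
  exact ⟨G, rfl⟩

lemma FFree.eCnt_le {n : ℕ} {G : SimpleGraph (Fin n)} (h : FFree F G) : eCnt G ≤ exNum n F :=
  le_csSup (finite_eCnt_set n F).bddAbove ⟨G, h, rfl⟩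

lemma exists_extremal {n : ℕ} (h : exNum n F ≠ 0) :
    ∃ G : SimpleGraph (Fin n), FFree F G ∧ eCnt G = exNum n F := by
  refine Nat.sSup_mem ?_ (finite_eCnt_set n F).bddAbove
  by_contra h0
  rw [Set.not_nonempty_iff_eq_empty] at h0
  exact h (by rw [exNum, h0]; simp)

variable {n r : ℕ}

lemma adjMat_comap {m : ℕ} (G : SimpleGraph (Fin n)) (f : Fin m → Fin n) (u v : Fin m) :
    adjMat (G.comap f) u v = adjMat G (f u) (f v) := by
  by_cases h : G.Adj (f u) (f v)
  · rw [adjMat_of_adj h, adjMat_of_adj (G := G.comap f) h]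
  · rw [adjMat_of_not_adj h, adjMat_of_not_adj (G := G.comap f) h]

/-- In an `F`-free graph, a balanced `r`-partite vertex set with large parts of equal sizes spans
at most `a` more edges than the complete `r`-partite graph on it. -/
lemma excess_le {a s : ℕ} (hr : 0 < r)
    (hex : exNum (r * s) F ≤ eCnt (turanGraph (r * s) r) + a)
    {G : SimpleGraph (Fin n)} (hG : FFree F G) (c : Fin n → Fin r) (P : Finset (Fin n))
    (hP : ∀ i, (P.filter fun v => c v = i).card = s) :
    ∑ u ∈ P, ∑ v ∈ P, inEdge G c u v - ∑ u ∈ P, ∑ v ∈ P, misEdge G c u v ≤ 2 * a := by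
  have hcard : P.card = r * s := by
    rw [Finset.card_eq_sum_card_fiberwise (f := c) (t := Finset.univ) (fun _ _ => by simp)]
    simp [hP]
  set f : Fin (r * s) → Fin n := fun j => P.orderEmbOfFin hcard j with hf
  have hinj : Function.Injective f := (P.orderEmbOfFin hcard).injective
  have himg : Finset.univ.image f = P := by
    apply Finset.coe_injective
    simp [hf]
  have hsum : ∀ g : Fin n → ℝ, ∑ u ∈ P, g u = ∑ u, g (f u) := by
    intro g
    rw [← himg, Finset.sum_image (fun _ _ _ _ h => hinj h)]
  have hcls : ∀ i, clsCard (c ∘ f) i = s := by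
    intro i
    refine Eq.trans ?_ (hP i)
    rw [← himg, Finset.filter_image, Finset.card_image_of_injective _ hinj]
    rfl
  have hbal : EquiColoring (c ∘ f) := by
    intro i
    left
    rw [hcls, Nat.mul_div_cancel_left _ hr]
  have h1 := two_mul_eCnt (G.comap f) (c ∘ f)
  have h2 := hbal.two_mul_eCnt_turanGraph hr
  have h3 : (eCnt (G.comap f) : ℝ) ≤ eCnt (turanGraph (r * s) r) + a := by
    exact_mod_cast (hG.comap hinj).eCnt_le.trans hex
  have h4 : ∀ u v, inEdge (G.comap f) (c ∘ f) u v = inEdge G c (f u) (f v) := by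
    intro u v; simp [inEdge, adjMat_comap]
  have h5 : ∀ u v, misEdge (G.comap f) (c ∘ f) u v = misEdge G c (f u) (f v) := by
    intro u v; simp [misEdge, adjMat_comap]
  simp only [h4, h5, Fintype.card_fin] at h1
  simp only [hsum]
  linarith

end extremal

section structure_lemmas

variable {n r : ℕ}

open scoped Classical in
/-- The number of elements of `S` that are not adjacent to `v`. -/
noncomputable def nonAdj (G : SimpleGraph (Fin n)) (v : Fin n) (S : Finset (Fin n)) : ℕ :=
  (S.filter fun u => ¬ G.Adj v u).card

open scoped Classical in
/-- The elements of `S` that are adjacent to all elements of `Z`. -/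
noncomputable def commonIn (G : SimpleGraph (Fin n)) (Z S : Finset (Fin n)) : Finset (Fin n) :=
  S.filter fun u => ∀ z ∈ Z, G.Adj z u

lemma mem_commonIn {G : SimpleGraph (Fin n)} {Z S : Finset (Fin n)} {u : Fin n} :
    u ∈ commonIn G Z S ↔ u ∈ S ∧ ∀ z ∈ Z, G.Adj z u := by
  simp [commonIn]

lemma nonAdj_mono (G : SimpleGraph (Fin n)) (v : Fin n) {S T : Finset (Fin n)} (h : S ⊆ T) :
    nonAdj G v S ≤ nonAdj G v T := by
  classical
  exact Finset.card_le_card (Finset.filter_subset_filter _ h)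

lemma card_le_commonIn_add (G : SimpleGraph (Fin n)) (Z S : Finset (Fin n)) :
    S.card ≤ (commonIn G Z S).card + ∑ z ∈ Z, nonAdj G z S := by
  classical
  have h : S ⊆ commonIn G Z S ∪ Z.biUnion fun z => S.filter fun u => ¬ G.Adj z u := by
    intro u hu
    by_cases h : ∀ z ∈ Z, G.Adj z u
    · exact Finset.mem_union_left _ (mem_commonIn.2 ⟨hu, h⟩)
    · push Not at h
      obtain ⟨z, hz, hzu⟩ := h
      exact Finset.mem_union_right _ (Finset.mem_biUnion.2 ⟨z, hz, by simp [hu, hzu]⟩)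
  refine (Finset.card_le_card h).trans ((Finset.card_union_le _ _).trans ?_)
  refine Nat.add_le_add_left (Finset.card_biUnion_le.trans (le_of_eq ?_)) _
  exact Finset.sum_congr rfl fun z _ => by unfold nonAdj; congr

lemma card_commonIn_singleton (G : SimpleGraph (Fin n)) (v : Fin n) (S : Finset (Fin n)) :
    (commonIn G {v} S).card + nonAdj G v S = S.card := by
  classical
  rw [← Finset.card_filter_add_card_filter_not (s := S) (fun u => G.Adj v u)]
  unfold nonAdj commonIn
  congr 3
  · ext; simp

lemma exists_complete_subparts (G : SimpleGraph (Fin n)) (s : ℕ) (X : Fin r → Finset (Fin n))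
    (hX : ∀ j, 2 * s ≤ (X j).card)
    (hmiss : ∀ j k, j ≠ k → ∀ x ∈ X k, 2 * r * s * nonAdj G x (X j) ≤ (X j).card) :
    ∃ Y : Fin r → Finset (Fin n), (∀ j, Y j ⊆ X j ∧ (Y j).card = s) ∧
      ∀ j k, j ≠ k → ∀ x ∈ Y j, ∀ y ∈ Y k, G.Adj x y := by
  classical
  have key : ∀ S : Finset (Fin r), ∃ Y : Fin r → Finset (Fin n),
      (∀ j ∈ S, Y j ⊆ X j ∧ (Y j).card = s) ∧
      ∀ j ∈ S, ∀ k ∈ S, j ≠ k → ∀ x ∈ Y j, ∀ y ∈ Y k, G.Adj x y := by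
    intro S
    induction S using Finset.induction_on with
    | empty => exact ⟨fun _ => ∅, by simp, by simp⟩
    | insert i S hi ih =>
      obtain ⟨Y, hY, hadj⟩ := ih
      set Z := S.biUnion Y with hZ
      have hZc : Z.card ≤ r * s := by
        refine Finset.card_biUnion_le.trans ?_
        rw [Finset.sum_congr rfl fun j hj => (hY j hj).2, Finset.sum_const, smul_eq_mul]
        exact Nat.mul_le_mul_right _ (by simpa using Finset.card_le_univ S)
      have hc := card_le_commonIn_add G Z (X i)
      have hlarge : s ≤ (commonIn G Z (X i)).card := by
        have h1 : 2 * r * s * ∑ z ∈ Z, nonAdj G z (X i) ≤ r * s * (X i).card := by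
          rw [Finset.mul_sum]
          refine (Finset.sum_le_card_nsmul _ _ (X i).card fun z hz => ?_).trans ?_
          · obtain ⟨k, hk, hzk⟩ := Finset.mem_biUnion.1 hz
            exact hmiss i k (fun h => hi (h ▸ hk)) z ((hY k hk).1 hzk)
          · rw [smul_eq_mul]
            exact Nat.mul_le_mul_right _ hZc
        rcases Nat.eq_zero_or_pos s with h0 | hs
        · omega
        have hrs : 0 < r * s := Nat.mul_pos (Fin.pos i) hs
        have h2 : 2 * ∑ z ∈ Z, nonAdj G z (X i) ≤ (X i).card := by
          refine Nat.le_of_mul_le_mul_left ?_ hrs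
          calc r * s * (2 * ∑ z ∈ Z, nonAdj G z (X i))
              = 2 * r * s * ∑ z ∈ Z, nonAdj G z (X i) := by ring
            _ ≤ _ := h1
        have := hX i
        omega
      obtain ⟨Q, hQ, hQc⟩ := Finset.exists_subset_card_eq hlarge
      refine ⟨Function.update Y i Q, ?_, ?_⟩
      · intro j hj
        by_cases hji : j = i
        · subst hji
          rw [Function.update_self]
          exact ⟨fun u hu => (mem_commonIn.1 (hQ hu)).1, hQc⟩
        · rw [Function.update_of_ne hji]
          exact hY j (Finset.mem_of_mem_insert_of_ne hj hji)
      · have hQadj : ∀ k ∈ S, ∀ y ∈ Y k, ∀ x ∈ Q, G.Adj y x := fun k hk y hy x hx =>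
          (mem_commonIn.1 (hQ hx)).2 y (Finset.mem_biUnion.2 ⟨k, hk, hy⟩)
        intro j hj k hk hjk x hx y hy
        by_cases hji : j = i
        · subst hji
          rw [Function.update_self] at hx
          rw [Function.update_of_ne hjk.symm] at hy
          exact (hQadj k (Finset.mem_of_mem_insert_of_ne hk hjk.symm) y hy x hx).symm
        · rw [Function.update_of_ne hji] at hx
          have hjS := Finset.mem_of_mem_insert_of_ne hj hji
          by_cases hki : k = i
          · subst hki
            rw [Function.update_self] at hy
            exact hQadj j hjS x hx y hy
          · rw [Function.update_of_ne hki] at hy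
            exact hadj j hjS k (Finset.mem_of_mem_insert_of_ne hk hki) hjk x hx y hy
  obtain ⟨Y, h1, h2⟩ := key Finset.univ
  exact ⟨Y, fun j => h1 j (Finset.mem_univ j),
    fun j k => h2 j (Finset.mem_univ j) k (Finset.mem_univ k)⟩

variable {W : Type*} {F : SimpleGraph W}

/-- A complete `r`-partite subgraph with equal large parts spans at most `a` further edges. -/
lemma sum_adjMat_le_of_complete {a s : ℕ} (hr : 0 < r)
    (hex : exNum (r * s) F ≤ eCnt (turanGraph (r * s) r) + a)
    {G : SimpleGraph (Fin n)} (hG : FFree F G) (P : Fin r → Finset (Fin n))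
    (hP : ∀ j, (P j).card = s) (hadj : ∀ j k, j ≠ k → ∀ x ∈ P j, ∀ y ∈ P k, G.Adj x y)
    (i : Fin r) : ∑ u ∈ P i, ∑ v ∈ P i, adjMat G u v ≤ 2 * a := by
  classical
  have hdisj : ∀ j k x, x ∈ P j → x ∈ P k → j = k := by
    intro j k x hj hk
    by_contra h
    exact G.irrefl (hadj j k h x hj x hk)
  set c : Fin n → Fin r := fun v => if h : ∃ j, v ∈ P j then h.choose else i with hc
  have hcP : ∀ j, ∀ x ∈ P j, c x = j := by
    intro j x hx
    have h : ∃ j, x ∈ P j := ⟨j, hx⟩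
    simp only [hc, dif_pos h]
    exact hdisj _ _ x h.choose_spec hx
  set Q := Finset.univ.biUnion P with hQ
  have hmem : ∀ x, x ∈ Q → x ∈ P (c x) := by
    intro x hx
    obtain ⟨j, -, hj⟩ := Finset.mem_biUnion.1 hx
    rwa [hcP j x hj]
  have hfil : ∀ j, (Q.filter fun v => c v = j) = P j := by
    intro j
    ext x
    constructor
    · intro h
      obtain ⟨h1, h2⟩ := Finset.mem_filter.1 h
      exact h2 ▸ hmem x h1
    · intro h
      exact Finset.mem_filter.2
        ⟨Finset.mem_biUnion.2 ⟨j, Finset.mem_univ _, h⟩, hcP j x h⟩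
  have h := excess_le hr hex hG c Q (fun j => by rw [hfil, hP])
  have h0 : ∑ u ∈ Q, ∑ v ∈ Q, misEdge G c u v = 0 := by
    refine Finset.sum_eq_zero fun u hu => Finset.sum_eq_zero fun v hv => ?_
    unfold misEdge
    split_ifs with huv
    · rfl
    · rw [adjMat_of_adj (hadj _ _ huv u (hmem u hu) v (hmem v hv)), sub_self]
  have hsub : P i ⊆ Q := fun x hx => Finset.mem_biUnion.2 ⟨i, Finset.mem_univ _, hx⟩
  have h1 : ∑ u ∈ P i, ∑ v ∈ P i, adjMat G u v ≤ ∑ u ∈ Q, ∑ v ∈ Q, inEdge G c u v := by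
    refine le_trans (Finset.sum_le_sum fun u hu => ?_)
      (Finset.sum_le_sum_of_subset_of_nonneg hsub fun u _ _ =>
        Finset.sum_nonneg fun v _ => inEdge_nonneg G c u v)
    refine le_trans (Finset.sum_le_sum fun v hv => ?_)
      (Finset.sum_le_sum_of_subset_of_nonneg hsub fun v _ _ => inEdge_nonneg G c u v)
    rw [inEdge, if_pos (by rw [hcP i u hu, hcP i v hv])]
  linarith

lemma sum_adjMat_mono (G : SimpleGraph (Fin n)) {Z Z' : Finset (Fin n)} (h : Z ⊆ Z') :
    ∑ u ∈ Z, ∑ v ∈ Z, adjMat G u v ≤ ∑ u ∈ Z', ∑ v ∈ Z', adjMat G u v :=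
  le_trans (Finset.sum_le_sum fun u _ => Finset.sum_le_sum_of_subset_of_nonneg h
      fun v _ _ => adjMat_nonneg G u v)
    (Finset.sum_le_sum_of_subset_of_nonneg h fun u _ _ =>
      Finset.sum_nonneg fun v _ => adjMat_nonneg G u v)

/-- If `Z` is complete to all but the `i`-th part of a nearly complete `r`-partite graph, then
`Z` spans at most `a` edges. -/
lemma sum_adjMat_le_of_attached {a s : ℕ} (hr : 0 < r)
    (hex : exNum (r * s) F ≤ eCnt (turanGraph (r * s) r) + a)
    {G : SimpleGraph (Fin n)} (hG : FFree F G) (X : Fin r → Finset (Fin n))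
    (hX : ∀ j, 2 * s ≤ (X j).card)
    (hmiss : ∀ j k, j ≠ k → ∀ x ∈ X k, 2 * r * s * nonAdj G x (X j) ≤ (X j).card)
    (i : Fin r) (Z : Finset (Fin n)) (hZs : Z.card ≤ s)
    (hZX : ∀ j, j ≠ i → ∀ z ∈ Z, ∀ x ∈ X j, G.Adj z x) :
    ∑ u ∈ Z, ∑ v ∈ Z, adjMat G u v ≤ 2 * a := by
  classical
  obtain ⟨Y, hY, hadj⟩ := exists_complete_subparts G s X hX hmiss
  obtain ⟨Q, hZQ, hQ, hQc⟩ := Finset.exists_subsuperset_card_eq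
    (Finset.subset_union_left : Z ⊆ Z ∪ Y i) hZs
    ((hY i).2.symm.le.trans (Finset.card_le_card Finset.subset_union_right))
  have hQadj : ∀ k, k ≠ i → ∀ x ∈ Q, ∀ y ∈ Y k, G.Adj x y := by
    intro k hk x hx y hy
    rcases Finset.mem_union.1 (hQ hx) with h | h
    · exact hZX k hk x h y ((hY k).1 hy)
    · exact hadj i k hk.symm x h y hy
  have h := sum_adjMat_le_of_complete hr hex hG (Function.update Y i Q) (fun j => ?_) ?_ i
  · rw [Function.update_self] at h
    exact (sum_adjMat_mono G hZQ).trans h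
  · by_cases hji : j = i
    · subst hji; rw [Function.update_self, hQc]
    · rw [Function.update_of_ne hji, (hY j).2]
  · intro j k hjk x hx y hy
    by_cases hji : j = i
    · subst hji
      rw [Function.update_self] at hx
      rw [Function.update_of_ne hjk.symm] at hy
      exact hQadj k hjk.symm x hx y hy
    · rw [Function.update_of_ne hji] at hx
      by_cases hki : k = i
      · subst hki
        rw [Function.update_self] at hy
        exact (hQadj j hji y hy x hx).symm
      · rw [Function.update_of_ne hki] at hy
        exact hadj j k hjk x hx y hy

lemma two_mul_card_le_sum_star (G : SimpleGraph (Fin n)) (v : Fin n) (S : Finset (Fin n))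
    (hS : ∀ u ∈ S, G.Adj v u) :
    2 * (S.card : ℝ) ≤ ∑ x ∈ insert v S, ∑ y ∈ insert v S, adjMat G x y := by
  have hv : v ∉ S := fun h => G.irrefl (hS v h)
  rw [Finset.sum_insert hv]
  have h1 : (S.card : ℝ) ≤ ∑ y ∈ insert v S, adjMat G v y := by
    rw [Finset.sum_insert hv, Finset.sum_congr rfl fun u hu => adjMat_of_adj (hS u hu)]
    simpa using adjMat_nonneg G v v
  have h2 : (S.card : ℝ) ≤ ∑ x ∈ S, ∑ y ∈ insert v S, adjMat G x y := by
    have : (S.card : ℝ) = ∑ x ∈ S, (1 : ℝ) := by simp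
    rw [this]
    refine Finset.sum_le_sum fun x hx => ?_
    rw [← adjMat_of_adj (hS x hx).symm]
    exact Finset.single_le_sum (f := fun y => adjMat G x y) (fun y _ => adjMat_nonneg G x y)
      (Finset.mem_insert_self v S)
  linarith

lemma exists_small_dense (G : SimpleGraph (Fin n)) (U : Finset (Fin n)) (t : ℝ)
    (hU : t < ∑ u ∈ U, ∑ v ∈ U, adjMat G u v) (k : ℕ) :
    ∃ Z ⊆ U, Z.card ≤ 2 * k ∧
      (2 * (k : ℝ) ≤ ∑ u ∈ Z, ∑ v ∈ Z, adjMat G u v ∨ t < ∑ u ∈ Z, ∑ v ∈ Z, adjMat G u v) := by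
  classical
  induction k with
  | zero => exact ⟨∅, by simp, by simp, by simp⟩
  | succ k ih =>
    obtain ⟨Z, hZU, hZc, hZ⟩ := ih
    by_cases ht : t < ∑ u ∈ Z, ∑ v ∈ Z, adjMat G u v
    · exact ⟨Z, hZU, by omega, Or.inr ht⟩
    replace hZ := hZ.resolve_right ht
    by_cases hall : ∀ u ∈ U, ∀ v ∈ U, G.Adj u v → u ∈ Z ∧ v ∈ Z
    · exfalso
      refine ht (hU.trans_le (le_of_eq ?_))
      symm
      rw [Finset.sum_subset hZU]
      · refine Finset.sum_congr rfl fun u hu => Finset.sum_subset hZU fun v hv hvZ => ?_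
        exact adjMat_of_not_adj fun h => hvZ (hall u hu v hv h).2
      · intro u hu huZ
        exact Finset.sum_eq_zero fun v hv =>
          adjMat_of_not_adj fun h => huZ (hall u hu v (hZU hv) h).1
    · push Not at hall
      obtain ⟨u, hu, v, hv, huv, hnot⟩ := hall
      have key : ∀ x ∈ U, ∀ y ∈ U, G.Adj x y → x ∉ Z → ∃ Z' ⊆ U, Z'.card ≤ 2 * (k + 1) ∧
          (2 * ((k + 1 : ℕ) : ℝ) ≤ ∑ u ∈ Z', ∑ v ∈ Z', adjMat G u v) := by
        intro x hx y hy hxy hxZ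
        refine ⟨insert x (insert y Z), ?_, ?_, ?_⟩
        · exact Finset.insert_subset hx (Finset.insert_subset hy hZU)
        · have h1 := Finset.card_insert_le x (insert y Z)
          have h2 := Finset.card_insert_le y Z
          omega
        · set Q := insert y Z with hQ
          have hxQ : x ∉ Q := by simp [hQ, hxZ, hxy.ne]
          have hyQ : y ∈ Q := Finset.mem_insert_self _ _
          have hmono := sum_adjMat_mono G (Finset.subset_insert y Z)
          rw [Finset.sum_insert hxQ, Finset.sum_insert hxQ]
          have h1 : 1 ≤ ∑ w ∈ Q, adjMat G x w := by
            rw [← adjMat_of_adj hxy]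
            exact Finset.single_le_sum (f := fun w => adjMat G x w)
              (fun w _ => adjMat_nonneg G x w) hyQ
          have h2 : 1 ≤ ∑ w ∈ Q, adjMat G w x := by
            rw [← adjMat_of_adj hxy.symm]
            exact Finset.single_le_sum (f := fun w => adjMat G w x)
              (fun w _ => adjMat_nonneg G w x) hyQ
          have h3 : ∑ w ∈ Q, ∑ v ∈ insert x Q, adjMat G w v
              = ∑ w ∈ Q, adjMat G w x + ∑ w ∈ Q, ∑ v ∈ Q, adjMat G w v := by
            rw [← Finset.sum_add_distrib]
            exact Finset.sum_congr rfl fun w _ => Finset.sum_insert hxQ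
          rw [h3]
          have h4 := adjMat_nonneg G x x
          push_cast
          linarith
      by_cases huZ : u ∈ Z
      · obtain ⟨Z', h1, h2, h3⟩ := key v hv u hu huv.symm (hnot huZ)
        exact ⟨Z', h1, h2, Or.inl h3⟩
      · obtain ⟨Z', h1, h2, h3⟩ := key u hu v hv huv huZ
        exact ⟨Z', h1, h2, Or.inl h3⟩

end structure_lemmas

section partition

variable {n r : ℕ} {W : Type*} {F : SimpleGraph W}

lemma sum_adjMat_le_of_common {a s : ℕ} (hr : 0 < r)
    (hex : exNum (r * s) F ≤ eCnt (turanGraph (r * s) r) + a)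
    {G : SimpleGraph (Fin n)} (hG : FFree F G) (B : Fin r → Finset (Fin n)) {m L : ℝ}
    (hm : ∀ j k, j ≠ k → ∀ x ∈ B k, (nonAdj G x (B j) : ℝ) ≤ m)
    (hsL : 2 * s ≤ L) (hmL : 2 * r * s * m ≤ L)
    (i : Fin r) (hBi : L ≤ (B i).card) (Z : Finset (Fin n)) (hZs : Z.card ≤ s)
    (hZ : ∀ j, j ≠ i → L ≤ (commonIn G Z (B j)).card) :
    ∑ u ∈ Z, ∑ v ∈ Z, adjMat G u v ≤ 2 * a := by
  classical
  set X : Fin r → Finset (Fin n) := fun j => if j = i then B j else commonIn G Z (B j) with hX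
  have hsub : ∀ j, X j ⊆ B j := by
    intro j
    simp only [hX]
    split_ifs
    · exact subset_rfl
    · exact fun x hx => (mem_commonIn.1 hx).1
  have hL : ∀ j, L ≤ (X j).card := by
    intro j
    simp only [hX]
    split_ifs with h
    · rw [h]; exact hBi
    · exact hZ j h
  refine sum_adjMat_le_of_attached hr hex hG X (fun j => ?_) (fun j k hjk x hx => ?_) i Z hZs ?_
  · exact_mod_cast hsL.trans (hL j)
  · have h1 : (nonAdj G x (X j) : ℝ) ≤ m :=
      (Nat.cast_le.2 (nonAdj_mono G x (hsub j))).trans (hm j k hjk x (hsub k hx))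
    have h2 : 2 * r * s * (nonAdj G x (X j) : ℝ) ≤ (X j).card :=
      (mul_le_mul_of_nonneg_left h1 (by positivity)).trans (hmL.trans (hL j))
    exact_mod_cast h2
  · intro j hj z hz x hx
    simp only [hX, if_neg hj] at hx
    exact (mem_commonIn.1 hx).2 z hz

lemma card_commonIn_le_of_common {a s : ℕ} (hr : 0 < r) (hs : a + 2 ≤ s)
    (hex : exNum (r * s) F ≤ eCnt (turanGraph (r * s) r) + a)
    {G : SimpleGraph (Fin n)} (hG : FFree F G) (B : Fin r → Finset (Fin n)) {m L : ℝ}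
    (hm : ∀ j k, j ≠ k → ∀ x ∈ B k, (nonAdj G x (B j) : ℝ) ≤ m)
    (hsL : 2 * s ≤ L) (hmL : 2 * r * s * m ≤ L)
    (i : Fin r) (hBi : L ≤ (B i).card) (v : Fin n)
    (hv : ∀ j, j ≠ i → L + (a + 1) * m ≤ (commonIn G {v} (B j)).card) :
    (commonIn G {v} (B i)).card ≤ a := by
  classical
  by_contra hcon
  obtain ⟨S, hS, hSc⟩ := Finset.exists_subset_card_eq (Nat.succ_le_of_lt (not_le.1 hcon))
  have hSv : ∀ u ∈ S, G.Adj v u := fun u hu => (mem_commonIn.1 (hS hu)).2 v (Finset.mem_singleton_self v)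
  have hvS : v ∉ S := fun h => G.irrefl (hSv v h)
  have h1 := two_mul_card_le_sum_star G v S hSv
  have h2 := sum_adjMat_le_of_common hr hex hG B hm hsL hmL i hBi (insert v S)
    (by rw [Finset.card_insert_of_notMem hvS]; omega) (fun j hj => by
      have h3 := card_le_commonIn_add G (insert v S) (B j)
      rw [Finset.sum_insert hvS, ← card_commonIn_singleton G v (B j)] at h3
      have h4 : ∑ z ∈ S, (nonAdj G z (B j) : ℝ) ≤ (a + 1) * m := by
        refine (Finset.sum_le_card_nsmul _ _ m fun z hz =>
          hm j i hj z (mem_commonIn.1 (hS hz)).1).trans ?_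
        rw [hSc]; simp
      have h5 : ((commonIn G {v} (B j)).card : ℝ) + nonAdj G v (B j)
          ≤ (commonIn G (insert v S) (B j)).card
            + (nonAdj G v (B j) + ∑ z ∈ S, (nonAdj G z (B j) : ℝ)) := by exact_mod_cast h3
      have := hv j hj
      linarith)
  rw [hSc] at h1
  push_cast at h1
  linarith

lemma sum_nonAdj (G : SimpleGraph (Fin n)) (S : Finset (Fin n)) :
    ∑ v, nonAdj G v S = ∑ b ∈ S, nonAdj G b Finset.univ := by
  classical
  have h := Finset.sum_card_bipartiteAbove_eq_sum_card_bipartiteBelow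
    (s := Finset.univ) (t := S) (fun v u => ¬ G.Adj v u)
  unfold nonAdj
  simp only [Finset.bipartiteAbove, Finset.bipartiteBelow] at h
  convert h using 3
  · ext; simp [G.adj_comm]

/-- A large complete `r`-partite subgraph in an `F`-free graph of large minimum degree induces a
partition of almost all vertices into nearly independent sets. -/
lemma exists_almost_partition {a s k : ℕ} (hr : 0 < r) (hs : a + 2 ≤ s) (hk : 2 * s ≤ k)
    (hex : exNum (r * s) F ≤ eCnt (turanGraph (r * s) r) + a)
    {G : SimpleGraph (Fin n)} (hG : FFree F G) (B : Fin r → Finset (Fin n))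
    (hB : ∀ i, (B i).card = 4 * s * k) (hadj : ∀ j i, j ≠ i → ∀ x ∈ B j, ∀ y ∈ B i, G.Adj x y)
    {e : ℝ} (hdeg : ∀ v, (nonAdj G v Finset.univ : ℝ) ≤ (1 / r + e) * n) :
    ∃ X : Fin r → Finset (Fin n), (∀ i j, i ≠ j → Disjoint (X i) (X j)) ∧
      (∀ i, ∀ v ∈ X i, (commonIn G {v} (X i)).card ≤ a) ∧
      (k : ℝ) * (n - ∑ i, ((X i).card : ℝ)) ≤ n * (2 * s + 4 * r * s * k * e) := by
  classical
  have hs0 : 0 < s := by omega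
  have hk0 : 0 < k := by omega
  have hskT : 2 * s ≤ 4 * s * k := by nlinarith
  have hm : ∀ j i, j ≠ i → ∀ x ∈ B i, (nonAdj G x (B j) : ℝ) ≤ 0 := by
    intro j i hji x hx
    have : nonAdj G x (B j) = 0 := by
      unfold nonAdj
      rw [Finset.card_eq_zero, Finset.filter_eq_empty_iff]
      exact fun y hy h => h (hadj i j hji.symm x hx y hy)
    rw [this]; simp
  have hT : ∀ i, (2 * s : ℝ) ≤ (B i).card := by
    intro i; rw [hB]; exact_mod_cast hskT
  have htype : ∀ v, ∃ i, (commonIn G {v} (B i)).card < 2 * s := by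
    intro v
    by_contra! hcon
    have := card_commonIn_le_of_common hr hs hex hG B hm le_rfl (by simp) ⟨0, hr⟩ (hT _) v
      (fun j _ => by simpa using (by exact_mod_cast hcon j))
    have := hcon ⟨0, hr⟩
    omega
  choose t ht using htype
  set f : Fin n → ℕ := fun v => ∑ j, nonAdj G v (B j) with hf
  have hnon : ∀ v, 4 * s * k < nonAdj G v (B (t v)) + 2 * s := by
    intro v
    have h1 := card_commonIn_singleton G v (B (t v))
    have := ht v
    rw [hB] at h1
    omega
  set X : Fin r → Finset (Fin n) := fun i =>
    Finset.univ.filter fun v => t v = i ∧ f v ≤ 4 * s * k + k with hX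
  have hmemX : ∀ i v, v ∈ X i ↔ t v = i ∧ f v ≤ 4 * s * k + k := by simp [hX]
  have hgood : ∀ i, ∀ v ∈ X i, ∀ j, j ≠ i → nonAdj G v (B j) ≤ 2 * k := by
    intro i v hv j hj
    obtain ⟨rfl, hv2⟩ := (hmemX i v).1 hv
    have h1 : nonAdj G v (B j) + nonAdj G v (B (t v)) ≤ f v := by
      rw [← Finset.sum_pair (f := fun j => nonAdj G v (B j)) hj]
      exact Finset.sum_le_sum_of_subset (Finset.subset_univ _)
    have := hnon v
    omega
  refine ⟨X, ?_, ?_, ?_⟩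
  · intro i j hij
    rw [Finset.disjoint_left]
    intro v hv hv'
    exact hij (((hmemX i v).1 hv).1.symm.trans ((hmemX j v).1 hv').1)
  · intro i v hv
    by_contra hcon
    obtain ⟨S, hS, hSc⟩ := Finset.exists_subset_card_eq (Nat.succ_le_of_lt (not_le.1 hcon))
    have hSv : ∀ u ∈ S, G.Adj v u := fun u hu => (mem_commonIn.1 (hS hu)).2 v (Finset.mem_singleton_self v)
    have hvS : v ∉ S := fun h => G.irrefl (hSv v h)
    have hc : (insert v S).card ≤ s := by
      rw [Finset.card_insert_of_notMem hvS]; omega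
    have h1 := two_mul_card_le_sum_star G v S hSv
    have h2 := sum_adjMat_le_of_common hr hex hG B hm le_rfl (by simp) i (hT i) (insert v S) hc
      (fun j hj => by
        have h3 := card_le_commonIn_add G (insert v S) (B j)
        have h4 : ∑ z ∈ insert v S, nonAdj G z (B j) ≤ s * (2 * k) := by
          refine (Finset.sum_le_card_nsmul _ _ (2 * k) fun z hz => ?_).trans ?_
          · refine hgood i z ?_ j hj
            rcases Finset.mem_insert.1 hz with rfl | hz
            · exact hv
            · exact (mem_commonIn.1 (hS hz)).1
          · rw [smul_eq_mul]; exact Nat.mul_le_mul_right _ hc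
        rw [hB] at h3
        have h5 : 2 * s ≤ (commonIn G (insert v S) (B j)).card := by nlinarith
        exact_mod_cast h5)
    rw [hSc] at h1
    push_cast at h1
    linarith
  · set bad : Finset (Fin n) := Finset.univ.filter fun v => ¬ f v ≤ 4 * s * k + k with hbad
    have hpart : (n : ℝ) ≤ bad.card + ∑ i, ((X i).card : ℝ) := by
      have h1 : (Finset.univ : Finset (Fin n)) ⊆ bad ∪ Finset.univ.biUnion X := by
        intro v _
        by_cases hv : f v ≤ 4 * s * k + k
        · exact Finset.mem_union_right _
            (Finset.mem_biUnion.2 ⟨t v, Finset.mem_univ _, (hmemX _ _).2 ⟨rfl, hv⟩⟩)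
        · exact Finset.mem_union_left _ (by simpa [hbad] using hv)
      have h2 := (Finset.card_le_card h1).trans ((Finset.card_union_le _ _).trans
        (Nat.add_le_add_left Finset.card_biUnion_le _))
      rw [Finset.card_univ, Fintype.card_fin] at h2
      exact_mod_cast h2
    have hsum : ∑ v, (f v : ℝ) ≤ (4 * s * k) * n * (1 + r * e) := by
      have h1 : ∑ v, f v = ∑ j, ∑ b ∈ B j, nonAdj G b Finset.univ := by
        rw [hf, Finset.sum_comm]
        exact Finset.sum_congr rfl fun j _ => sum_nonAdj G (B j)
      have h2 : ∑ v, (f v : ℝ) = ∑ j, ∑ b ∈ B j, (nonAdj G b Finset.univ : ℝ) := by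
        exact_mod_cast h1
      rw [h2]
      have h3 : ∀ j : Fin r, ∑ b ∈ B j, (nonAdj G b Finset.univ : ℝ)
          ≤ (4 * s * k) * ((1 / r + e) * n) := by
        intro j
        refine (Finset.sum_le_card_nsmul _ _ _ fun b _ => hdeg b).trans (le_of_eq ?_)
        rw [hB, nsmul_eq_mul]; push_cast; ring
      refine (Finset.sum_le_sum fun j _ => h3 j).trans (le_of_eq ?_)
      rw [Finset.sum_const, Finset.card_univ, Fintype.card_fin, nsmul_eq_mul]
      have : (r : ℝ) ≠ 0 := by positivity
      field_simp
    have hlow : ∀ v, (4 * s * k - 2 * s : ℝ) + (if f v ≤ 4 * s * k + k then 0 else (k : ℝ))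
        ≤ f v := by
      intro v
      split_ifs with h
      · have h1 : nonAdj G v (B (t v)) ≤ f v :=
          Finset.single_le_sum (f := fun j => nonAdj G v (B j)) (fun _ _ => Nat.zero_le _)
            (Finset.mem_univ _)
        have h2 := hnon v
        have h3 : 4 * s * k ≤ f v + 2 * s := by omega
        have h4 : (4 * s * k : ℝ) ≤ f v + 2 * s := by exact_mod_cast h3
        linarith
      · have h3 : 4 * s * k + k ≤ f v := by omega
        have h4 : (4 * s * k + k : ℝ) ≤ f v := by exact_mod_cast h3
        have : (0 : ℝ) ≤ s := by positivity
        linarith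
    have htot := (Finset.sum_le_sum fun v (_ : v ∈ Finset.univ) => hlow v).trans hsum
    rw [Finset.sum_add_distrib, Finset.sum_const, Finset.card_univ, Fintype.card_fin,
      nsmul_eq_mul, Finset.sum_ite, Finset.sum_const_zero, zero_add, Finset.sum_const,
      nsmul_eq_mul] at htot
    have hk' : (0 : ℝ) ≤ k := by positivity
    have := mul_le_mul_of_nonneg_left hpart hk'
    have hb : ((Finset.univ.filter fun v => ¬ f v ≤ 4 * s * k + k).card : ℝ) = bad.card := rfl
    rw [hb] at htot
    nlinarith

end partition

section coloring

variable {n r : ℕ} {W : Type*} {F : SimpleGraph W}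

lemma sum_inEdge (G : SimpleGraph (Fin n)) (c : Fin n → Fin r) :
    ∑ u, ∑ v, inEdge G c u v = ∑ i, ∑ u ∈ Finset.univ.filter (fun v => c v = i),
      ∑ v ∈ Finset.univ.filter (fun v => c v = i), adjMat G u v := by
  classical
  rw [← Finset.sum_fiberwise (s := Finset.univ) (g := c)]
  refine Finset.sum_congr rfl fun i _ => Finset.sum_congr rfl fun u hu => ?_
  have hu : c u = i := by simpa using hu
  rw [Finset.sum_filter]
  refine Finset.sum_congr rfl fun v _ => ?_
  rw [inEdge, hu]
  simp only [eq_comm]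

lemma nonAdj_add_card_le {G : SimpleGraph (Fin n)} {v : Fin n} {S T : Finset (Fin n)}
    (h : Disjoint S T) :
    nonAdj G v S + T.card ≤ nonAdj G v Finset.univ + (commonIn G {v} T).card := by
  classical
  have h1 := card_commonIn_singleton G v T
  have h2 : nonAdj G v S + nonAdj G v T ≤ nonAdj G v Finset.univ := by
    unfold nonAdj
    rw [← Finset.card_union_of_disjoint (Finset.disjoint_filter_filter h)]
    exact Finset.card_le_card fun x hx => by
      rcases Finset.mem_union.1 hx with h | h <;> simp_all
  omega

/-- A partition of almost all vertices into nearly independent sets extends to a colouring of all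
vertices with a bounded number of monochromatic edges. -/
lemma exists_coloring_of_almost_partition {a s : ℕ} (hr : 2 ≤ r) (hs : 2 * a + 2 ≤ s)
    (hex : exNum (r * s) F ≤ eCnt (turanGraph (r * s) r) + a)
    {G : SimpleGraph (Fin n)} (hG : FFree F G) (X : Fin r → Finset (Fin n))
    (hdisj : ∀ i j, i ≠ j → Disjoint (X i) (X j))
    (hind : ∀ i, ∀ v ∈ X i, (commonIn G {v} (X i)).card ≤ a) {Q E : ℝ} (hE : 0 ≤ E)
    (hQ : (n : ℝ) = r * Q) (hQE : 100 * r ^ 2 * s * E ≤ Q)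
    (hdeg : ∀ v, (nonAdj G v Finset.univ : ℝ) ≤ Q + E)
    (hsum : (n : ℝ) ≤ ∑ i, ((X i).card : ℝ) + E) (haE : a ≤ E) (hsQ : 2 * s ≤ Q / 16) :
    ∃ c : Fin n → Fin r, ∑ u, ∑ v, inEdge G c u v ≤ 2 * r * a := by
  classical
  have hr0 : 0 < r := by omega
  have hr' : (2 : ℝ) ≤ r := by exact_mod_cast hr
  have hs' : (2 : ℝ) ≤ s := by exact_mod_cast (by omega : 2 ≤ s)
  have hrE : 0 ≤ r * E := by positivity
  have hrsE : 200 * (r * s * E) ≤ Q := by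
    have : 0 ≤ r * s * E := by positivity
    nlinarith
  have hrE400 : 400 * (r * E) ≤ Q := by nlinarith
  have hE800 : 2 * E ≤ r * E := by nlinarith
  have hup : ∀ i, ((X i).card : ℝ) ≤ Q + 2 * E := by
    intro i
    rcases (X i).eq_empty_or_nonempty with h | ⟨v, hv⟩
    · rw [h]; simp; linarith
    · have h1 := card_commonIn_singleton G v (X i)
      have h2 := hind i v hv
      have h3 := nonAdj_mono G v (Finset.subset_univ (X i))
      have h4 : (X i).card ≤ nonAdj G v Finset.univ + a := by omega
      have h5 : ((X i).card : ℝ) ≤ nonAdj G v Finset.univ + a := by exact_mod_cast h4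
      linarith [hdeg v]
  have hlow : ∀ i, Q - 2 * (r * E) ≤ ((X i).card : ℝ) := by
    intro i
    rw [← Finset.add_sum_erase _ _ (Finset.mem_univ i)] at hsum
    have h1 : ∑ j ∈ Finset.univ.erase i, ((X j).card : ℝ) ≤ (r - 1) * (Q + 2 * E) := by
      refine (Finset.sum_le_card_nsmul _ _ _ fun j _ => hup j).trans (le_of_eq ?_)
      rw [Finset.card_erase_of_mem (Finset.mem_univ i), Finset.card_univ, Fintype.card_fin,
        nsmul_eq_mul, Nat.cast_pred hr0]
    nlinarith
  have hmiss : ∀ i v, (commonIn G {v} (X i)).card ≤ a → ∀ j, j ≠ i →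
      (nonAdj G v (X j) : ℝ) ≤ 3 * (r * E) := by
    intro i v hv j hji
    have h1 := nonAdj_add_card_le (G := G) (v := v) (hdisj j i hji)
    have h2 : (nonAdj G v (X j) : ℝ) + (X i).card ≤ nonAdj G v Finset.univ + a := by
      exact_mod_cast h1.trans (Nat.add_le_add_left hv _)
    linarith [hdeg v, hlow i]
  have hm : ∀ j k, j ≠ k → ∀ x ∈ X k, (nonAdj G x (X j) : ℝ) ≤ 3 * (r * E) :=
    fun j k hjk x hx => hmiss k x (hind k x hx) j hjk
  have hmL : 2 * r * s * (3 * (r * E)) ≤ Q / 16 := by nlinarith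
  have hBi : ∀ i, Q / 16 ≤ ((X i).card : ℝ) := fun i => by linarith [hlow i]
  have htype : ∀ v, ∃ i, (commonIn G {v} (X i)).card ≤ a := by
    intro v
    have : Nonempty (Fin r) := ⟨⟨0, hr0⟩⟩
    obtain ⟨i, hi⟩ := Finite.exists_min fun i => (commonIn G {v} (X i)).card
    refine ⟨i, card_commonIn_le_of_common hr0 (by omega) hex hG X hm hsQ hmL i (hBi i) v ?_⟩
    intro j hji
    have ham : (a + 1) * (3 * (r * E)) ≤ Q / 50 := by
      have : (a + 1 : ℝ) ≤ s := by exact_mod_cast (by omega : a + 1 ≤ s)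
      nlinarith
    by_contra hcon
    have h1 := nonAdj_add_card_le (G := G) (v := v) (hdisj j i hji)
    have h2 := card_commonIn_singleton G v (X j)
    have h3 := hi j
    have h4 : (X j).card + (X i).card
        ≤ nonAdj G v Finset.univ + 2 * (commonIn G {v} (X j)).card := by omega
    have h5 : ((X j).card : ℝ) + (X i).card
        ≤ nonAdj G v Finset.univ + 2 * (commonIn G {v} (X j)).card := by exact_mod_cast h4
    linarith [hlow i, hlow j, hdeg v]
  choose c hc using htype
  refine ⟨c, ?_⟩
  rw [sum_inEdge]
  have hi : ∀ i, ∑ u ∈ Finset.univ.filter (fun v => c v = i),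
      ∑ v ∈ Finset.univ.filter (fun v => c v = i), adjMat G u v ≤ 2 * a := by
    intro i
    by_contra! hcon
    obtain ⟨Z, hZ, hZc, hZe⟩ := exists_small_dense G _ _ hcon (a + 1)
    have h := sum_adjMat_le_of_common hr0 hex hG X hm hsQ hmL i (hBi i) Z (by omega) (by
      intro j hji
      have h3 := card_le_commonIn_add G Z (X j)
      have h4 : ∑ z ∈ Z, (nonAdj G z (X j) : ℝ) ≤ s * (3 * (r * E)) := by
        refine (Finset.sum_le_card_nsmul _ _ (3 * (r * E)) fun z hz => ?_).trans ?_
        · have hz : c z = i := by simpa using hZ hz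
          exact hmiss i z (hz ▸ hc z) j hji
        · rw [nsmul_eq_mul]
          have : (Z.card : ℝ) ≤ s := by exact_mod_cast (by omega : Z.card ≤ s)
          exact mul_le_mul_of_nonneg_right this (by positivity)
      have h5 : ((X j).card : ℝ)
          ≤ (commonIn G Z (X j)).card + ∑ z ∈ Z, (nonAdj G z (X j) : ℝ) := by exact_mod_cast h3
      have := hlow j
      nlinarith)
    push_cast at hZe
    rcases hZe with h' | h' <;> linarith
  refine (Finset.sum_le_card_nsmul _ _ _ fun i _ => hi i).trans (le_of_eq ?_)
  rw [Finset.card_univ, Fintype.card_fin, nsmul_eq_mul]; ring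

end coloring

section erdos_stone

variable {n r : ℕ} {W : Type*} {F : SimpleGraph W}

lemma sum_adjMat_row (G : SimpleGraph (Fin n)) [DecidableRel G.Adj] (v : Fin n) :
    ∑ u, adjMat G v u = (G.degree v : ℝ) := by
  classical
  rw [← card_neighborFinset_eq_degree, neighborFinset_eq_filter, Finset.card_filter]
  push_cast
  refine Finset.sum_congr rfl fun u _ => ?_
  rw [adjMat_apply]
  congr

lemma nonAdj_univ (G : SimpleGraph (Fin n)) (v : Fin n) :
    (nonAdj G v Finset.univ : ℝ) = n - ∑ u, adjMat G v u := by
  classical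
  have h : ∑ u, adjMat G v u = ((Finset.univ.filter fun u => G.Adj v u).card : ℝ) := by
    rw [Finset.card_filter]
    push_cast
    refine Finset.sum_congr rfl fun u _ => ?_
    rw [adjMat_apply]
  have h2 := Finset.card_filter_add_card_filter_not (s := (Finset.univ : Finset (Fin n)))
    (fun u => G.Adj v u)
  rw [Finset.card_univ, Fintype.card_fin] at h2
  rw [h, eq_sub_iff_add_eq, add_comm]
  have h3 : ((Finset.univ.filter fun u => G.Adj v u).card : ℝ)
      + (Finset.univ.filter fun u => ¬ G.Adj v u).card = n := by exact_mod_cast h2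
  convert h3
  unfold nonAdj
  congr

lemma exists_complete_parts (hr : 2 ≤ r) (t : ℕ) :
    ∃ N : ℕ, ∀ n ≥ N, ∀ G : SimpleGraph (Fin n),
      (∀ v, (1 - 1 / r - 1 / (2 * r ^ 2)) * (n : ℝ) ≤ ∑ u, adjMat G v u) →
      ∃ B : Fin r → Finset (Fin n), (∀ i, (B i).card = t) ∧
        ∀ j i, j ≠ i → ∀ x ∈ B j, ∀ y ∈ B i, G.Adj x y := by
  classical
  obtain ⟨p, rfl⟩ : ∃ p, r = p + 1 := ⟨r - 1, by omega⟩
  have hp : (1 : ℝ) ≤ p := by exact_mod_cast (by omega : 1 ≤ p)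
  have h := eventually_completeEquipartiteGraph_isContained_of_minDegree
    (show (0 : ℝ) < 1 / (2 * ((p : ℝ) + 1) ^ 2) by positivity) p t
  obtain ⟨N, hN⟩ := Filter.eventually_atTop.1 h
  refine ⟨N + 1, fun n hn G hdeg => ?_⟩
  have : Nonempty (Fin n) := ⟨⟨0, by omega⟩⟩
  obtain ⟨v, hv⟩ := G.exists_minimal_degree_vertex
  have hd : (G.minDegree : ℝ) ≥ (1 - 1 / p + 1 / (2 * ((p : ℝ) + 1) ^ 2)) * n := by
    rw [hv, ← sum_adjMat_row]
    refine le_trans ?_ (hdeg v)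
    refine mul_le_mul_of_nonneg_right ?_ (by positivity)
    push_cast
    have h1 : 1 / (p : ℝ) - 1 / (p + 1) = 1 / (p * (p + 1)) := by
      field_simp; ring
    have h2 : 1 / ((p : ℝ) + 1) ^ 2 ≤ 1 / (p * (p + 1)) :=
      one_div_le_one_div_of_le (by positivity) (by nlinarith)
    have h3 : 1 / (2 * ((p : ℝ) + 1) ^ 2) = 1 / ((p : ℝ) + 1) ^ 2 / 2 := by field_simp
    rw [h3]
    linarith
  obtain ⟨f⟩ := hN n (by omega) (G := G) hd
  refine ⟨fun i => Finset.univ.image fun x => f (i, x), fun i => ?_, fun j i hji x hx y hy => ?_⟩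
  · rw [Finset.card_image_of_injective _ fun x y hxy => by simpa using f.injective hxy]
    simp
  · obtain ⟨x', -, rfl⟩ := Finset.mem_image.1 hx
    obtain ⟨y', -, rfl⟩ := Finset.mem_image.1 hy
    exact f.toHom.map_adj (by simpa using hji)

/-- An `F`-free graph with large minimum degree has an `r`-colouring with a bounded number of
monochromatic edges. -/
lemma exists_coloring_of_minDegree {a : ℕ} (hr : 2 ≤ r) (h : HypStar r a F) :
    ∃ ε : ℝ, 0 < ε ∧ ε ≤ 1 / 8 ∧ ∃ N : ℕ, ∀ n ≥ N, ∀ G : SimpleGraph (Fin n), FFree F G →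
      (∀ v, (1 - 1 / r - ε) * (n : ℝ) ≤ ∑ u, adjMat G v u) →
      ∃ c : Fin n → Fin r, ∑ u, ∑ v, inEdge G c u v ≤ 2 * r * a := by
  obtain ⟨m₀, hm₀⟩ := h
  set s := max (2 * a + 2) m₀ with hs
  have hsa : 2 * a + 2 ≤ s := le_max_left _ _
  have hex : exNum (r * s) F ≤ eCnt (turanGraph (r * s) r) + a :=
    (hm₀ (r * s) ((le_max_right _ _).trans (Nat.le_mul_of_pos_left _ (by omega)))).1.le
  have hr' : (2 : ℝ) ≤ r := by exact_mod_cast hr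
  have hs' : (2 : ℝ) ≤ s := by exact_mod_cast (by omega : 2 ≤ s)
  set k := 400 * r ^ 3 * s ^ 2 with hk
  obtain ⟨N, hN⟩ := exists_complete_parts hr (4 * s * k)
  set e : ℝ := 1 / (100 * r ^ 3 * s) with he
  have he0 : 0 < e := by positivity
  set ε : ℝ := e / (8 * r * s) with hε
  have hε0 : 0 < ε := by positivity
  have he1 : e ≤ 1 / (2 * r ^ 2) := by
    refine one_div_le_one_div_of_le (by positivity) ?_
    have h1 : 0 < (r : ℝ) ^ 2 := by positivity
    have h2 : (r : ℝ) ^ 3 = r ^ 2 * r := by ring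
    rw [h2]
    nlinarith [mul_nonneg h1.le (by nlinarith : (0 : ℝ) ≤ r * s - 4)]
  have hεe : ε ≤ e := div_le_self he0.le (by nlinarith)
  have he8 : (1 : ℝ) / (2 * r ^ 2) ≤ 1 / 8 :=
    one_div_le_one_div_of_le (by positivity) (by nlinarith)
  obtain ⟨N1, hN1⟩ := exists_nat_ge ((a : ℝ) / e)
  refine ⟨ε, hε0, by linarith, N + N1 + 32 * r * s, fun n hn G hG hdeg => ?_⟩
  have hn0 : (0 : ℝ) ≤ n := by positivity
  obtain ⟨B, hB, hadj⟩ := hN n (by nlinarith) G fun v => le_trans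
    (mul_le_mul_of_nonneg_right (by linarith) hn0) (hdeg v)
  have hnon : ∀ v, (nonAdj G v Finset.univ : ℝ) ≤ (1 / r + ε) * n := by
    intro v
    rw [nonAdj_univ]
    linarith [hdeg v]
  have hk2 : 2 * s ≤ k := by
    have h1 : 1 ≤ r ^ 3 := Nat.one_le_pow _ _ (by omega)
    have h2 : s ≤ s ^ 2 := Nat.le_self_pow (by norm_num) s
    rw [hk]; nlinarith
  obtain ⟨X, hX1, hX2, hX3⟩ := exists_almost_partition (by omega) (by omega) hk2 hex hG B hB hadj hnon
  refine exists_coloring_of_almost_partition hr hsa hex hG X hX1 hX2 (Q := n / r) (E := e * n)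
    (by positivity) (by field_simp) (le_of_eq ?_) (fun v => ?_) ?_ ?_ ?_
  · rw [he]; field_simp
  · refine (hnon v).trans ?_
    have := mul_le_mul_of_nonneg_right hεe hn0
    have h2 : (1 / (r : ℝ) + ε) * n = n / r + ε * n := by ring
    linarith
  · have hk0 : (0 : ℝ) < k := by
      exact_mod_cast (by omega : 0 < k)
    have h1 : (n : ℝ) * (2 * s + 4 * r * s * k * ε) = k * (e * n) := by
      rw [hε, he, hk]; push_cast; field_simp; ring
    rw [h1] at hX3
    linarith [le_of_mul_le_mul_left hX3 hk0]
  · have : (N1 : ℝ) ≤ n := by exact_mod_cast (by nlinarith : N1 ≤ n)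
    have h1 := hN1.trans this
    rw [div_le_iff₀ he0] at h1
    linarith
  · have h1 : (32 * r * s : ℝ) ≤ n := by exact_mod_cast (by omega : 32 * r * s ≤ n)
    rw [div_div, le_div_iff₀ (by positivity)]
    linarith

end erdos_stone

section deletion

variable {n : ℕ}

lemma IsPerron.le_card {V : Type*} [Fintype V] {G : SimpleGraph V} {l : ℝ} (h : IsPerron G l) :
    l ≤ Fintype.card V := by
  obtain ⟨⟨x, hx0, hxs, hx⟩, -⟩ := h
  have h1 : l * ∑ v, x v ≤ Fintype.card V * ∑ v, x v := by
    rw [Finset.mul_sum, ← Finset.sum_congr rfl fun v _ => hx v]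
    refine (Finset.sum_le_card_nsmul _ _ (∑ u, x u) fun v _ =>
      Finset.sum_le_sum fun u _ => ?_).trans ?_
    · exact mul_le_of_le_one_left (hx0 u) (adjMat_le_one G v u)
    · rw [nsmul_eq_mul, Finset.card_univ]
  exact le_of_mul_le_mul_right h1 hxs

lemma IsPerron.exists_unit {V : Type*} [Fintype V] {G : SimpleGraph V} {l : ℝ}
    (h : IsPerron G l) : ∃ x : V → ℝ, (∀ v, 0 ≤ x v) ∧ ∑ v, x v ^ 2 = 1 ∧
      ∀ v, ∑ u, adjMat G v u * x u = l * x v := by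
  obtain ⟨⟨x, hx0, hxs, hx⟩, -⟩ := h
  have hpos : 0 < ∑ v, x v ^ 2 := by
    obtain ⟨v, -, hv⟩ := Finset.exists_lt_of_sum_lt (s := Finset.univ) (f := fun _ => (0 : ℝ))
      (g := x) (by simpa using hxs)
    exact Finset.sum_pos' (fun v _ => sq_nonneg _) ⟨v, Finset.mem_univ _, pow_pos hv 2⟩
  set t := Real.sqrt (∑ v, x v ^ 2) with ht
  have ht0 : 0 < t := Real.sqrt_pos.2 hpos
  have ht2 : t ^ 2 = ∑ v, x v ^ 2 := Real.sq_sqrt hpos.le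
  refine ⟨fun v => x v / t, fun v => div_nonneg (hx0 v) ht0.le, ?_, fun v => ?_⟩
  · simp only [div_pow]
    rw [← Finset.sum_div, ht2, div_self hpos.ne']
  · simp only [← mul_div_assoc]
    rw [← Finset.sum_div, hx v]

lemma perron_entry_bound {ρ ε l d N μ : ℝ} (hρ : 1 / 2 ≤ ρ) (hε : 0 < ε) (hN : 0 ≤ N)
    (hd0 : 0 ≤ d) (hdN : d ≤ N) (hd : d < (ρ - ε) * N) (hl0 : 0 < l) (hlN : l ≤ N)
    (hlow : (ρ - ε / 2) * N ≤ l) (hcs : (l * μ) ^ 2 ≤ d * (1 - (N - d) * μ ^ 2)) :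
    l * μ ^ 2 ≤ ρ - ε ^ 2 / 16 := by
  have h1 : μ ^ 2 * (l ^ 2 + d * (N - d)) ≤ d := by nlinarith
  set D := l ^ 2 + d * (N - d) with hD
  have hD0 : 0 < D := by
    have := mul_nonneg hd0 (sub_nonneg.2 hdN)
    positivity
  have h2 : ρ * D - l * d = (l - d) * (ρ * l - (1 - ρ) * d) + d * (ρ * N - d) := by
    rw [hD]; ring
  have h3 : ε / 2 * N ≤ l - d := by linarith
  have h4 : 0 ≤ ε / 2 * N := by positivity
  have h5 : 1 / 2 * (l - d) ≤ ρ * l - (1 - ρ) * d := by nlinarith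
  have h6 : (ε / 2 * N) * (1 / 2 * (ε / 2 * N)) ≤ (l - d) * (ρ * l - (1 - ρ) * d) :=
    mul_le_mul h3 (by linarith) (by positivity) (by linarith)
  have h7 : 0 ≤ d * (ρ * N - d) := mul_nonneg hd0 (by nlinarith)
  have h8 : D ≤ 2 * N ^ 2 := by rw [hD]; nlinarith
  have h9 : ε ^ 2 / 16 * D ≤ ε ^ 2 / 16 * (2 * N ^ 2) :=
    mul_le_mul_of_nonneg_left h8 (by positivity)
  have h10 : l * d ≤ (ρ - ε ^ 2 / 16) * D := by nlinarith
  refine le_of_mul_le_mul_right ?_ hD0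
  nlinarith [mul_le_mul_of_nonneg_left h1 hl0.le]

lemma deletion_bound {ρ ε l l' N μ : ℝ} (hρ1 : ρ ≤ 1) (hε : 0 < ε)
    (hε2 : ε ≤ 1 / 2) (hμN : N * μ ^ 2 ≤ 1) (hnN : 32 ≤ ε ^ 2 * N)
    (hkey : l * μ ^ 2 ≤ ρ - ε ^ 2 / 16) (hray : l * (1 - 2 * μ ^ 2) ≤ l' * (1 - μ ^ 2)) :
    l - ρ + ε ^ 2 / 32 ≤ l' := by
  have hm : 0 ≤ μ ^ 2 := sq_nonneg μ
  have hμs : 32 * μ ^ 2 ≤ ε ^ 2 := by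
    have h1 : 32 * μ ^ 2 ≤ ε ^ 2 * N * μ ^ 2 := mul_le_mul_of_nonneg_right hnN hm
    have h2 : ε ^ 2 * (N * μ ^ 2) ≤ ε ^ 2 * 1 := mul_le_mul_of_nonneg_left hμN (sq_nonneg ε)
    linarith
  have hε4 : ε ^ 2 ≤ 1 / 4 := by nlinarith
  generalize μ ^ 2 = m at *
  generalize hE : ε ^ 2 = E at *
  have hE0 : 0 < E := by rw [← hE]; positivity
  by_contra! hcon
  have h1 : l' * (1 - m) < (l - ρ + E / 32) * (1 - m) :=
    mul_lt_mul_of_pos_right hcon (by linarith)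
  have h2 : (ρ - E / 32) * m ≤ m := mul_le_of_le_one_left hm (by linarith)
  nlinarith

/-- Deleting a suitable vertex from a graph with large spectral radius and small minimum degree
decreases the spectral radius only slightly. -/
lemma exists_deletion {ρ ε l : ℝ} (hρ : 1 / 2 ≤ ρ) (hρ1 : ρ ≤ 1) (hε : 0 < ε)
    {G : SimpleGraph (Fin (n + 1))} (hl : IsPerron G l)
    (hlow : (ρ - ε / 2) * (n + 1 : ℝ) ≤ l) (hε2 : ε ≤ 1 / 2)
    (hn : 32 / ε ^ 2 ≤ n) (w : Fin (n + 1)) (hw : ∑ u, adjMat G w u < (ρ - ε) * (n + 1 : ℝ)) :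
    ∃ u : Fin (n + 1), ∀ l', IsPerron (G.comap u.succAbove) l' → l - ρ + ε ^ 2 / 32 ≤ l' := by
  obtain ⟨x, hx0, hx1, hx⟩ := hl.exists_unit
  have hlN : l ≤ n + 1 := by
    have := hl.le_card
    rw [Fintype.card_fin] at this
    exact_mod_cast this
  obtain ⟨u, hu⟩ := Finite.exists_min x
  refine ⟨u, fun l' hl' => ?_⟩
  set N : ℝ := n + 1 with hN
  have hN1 : 1 ≤ N := by rw [hN]; linarith [Nat.cast_nonneg (α := ℝ) n]
  set d := ∑ v, adjMat G w v with hd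
  have hd0 : 0 ≤ d := Finset.sum_nonneg fun v _ => adjMat_nonneg G w v
  set μ := x u with hμ
  have hμ0 : 0 ≤ μ := hx0 u
  have hl0 : 0 < l := by nlinarith
  have hμN : N * μ ^ 2 ≤ 1 := by
    rw [← hx1]
    have := Finset.card_nsmul_le_sum Finset.univ (fun v => x v ^ 2) (μ ^ 2) fun v _ =>
      pow_le_pow_left₀ hμ0 (hu v) 2
    rw [nsmul_eq_mul, Finset.card_univ, Fintype.card_fin] at this
    rw [hN]; exact_mod_cast this
  have hA2 : ∀ v, adjMat G w v ^ 2 = adjMat G w v := by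
    intro v
    by_cases h : G.Adj w v
    · rw [adjMat_of_adj h]; norm_num
    · rw [adjMat_of_not_adj h]; norm_num
  have hcs : (l * μ) ^ 2 ≤ d * (1 - (N - d) * μ ^ 2) := by
    have h1 : (l * μ) ^ 2 ≤ (∑ v, adjMat G w v * x v) ^ 2 := by
      rw [hx w]
      exact pow_le_pow_left₀ (by positivity) (mul_le_mul_of_nonneg_left (hu w) hl0.le) 2
    have h2 : (∑ v, adjMat G w v * x v) ^ 2 ≤ d * ∑ v, adjMat G w v * x v ^ 2 := by
      have := Finset.sum_mul_sq_le_sq_mul_sq Finset.univ (fun v => adjMat G w v)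
        (fun v => adjMat G w v * x v)
      simp only [← mul_assoc, ← pow_two, mul_pow, hA2] at this
      exact this
    have h3 : ∑ v, adjMat G w v * x v ^ 2 ≤ 1 - (N - d) * μ ^ 2 := by
      have h4 : ∑ v, (1 - adjMat G w v) * μ ^ 2 ≤ ∑ v, (1 - adjMat G w v) * x v ^ 2 :=
        Finset.sum_le_sum fun v _ => mul_le_mul_of_nonneg_left
          (pow_le_pow_left₀ hμ0 (hu v) 2) (sub_nonneg.2 (adjMat_le_one G w v))
      have h5 : ∑ v, (1 - adjMat G w v) * x v ^ 2 = 1 - ∑ v, adjMat G w v * x v ^ 2 := by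
        simp only [sub_mul, one_mul]
        rw [Finset.sum_sub_distrib, hx1]
      have h6 : ∑ v, (1 - adjMat G w v) * μ ^ 2 = (N - d) * μ ^ 2 := by
        rw [← Finset.sum_mul, Finset.sum_sub_distrib]
        simp [hN, hd]
      linarith
    exact h1.trans (h2.trans (mul_le_mul_of_nonneg_left h3 hd0))
  have hdN : d ≤ N := by nlinarith
  have hkey : l * μ ^ 2 ≤ ρ - ε ^ 2 / 16 :=
    perron_entry_bound hρ hε (by linarith) hd0 hdN hw hl0 hlN hlow hcs
  have hray : l * (1 - 2 * μ ^ 2) ≤ l' * (1 - μ ^ 2) := by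
    have h1 := hl'.2 fun v => x (u.succAbove v)
    simp only [adjMat_comap] at h1
    have h2 : ∑ v, x (u.succAbove v) ^ 2 = 1 - μ ^ 2 := by
      rw [Fin.sum_univ_succAbove _ u] at hx1
      linarith
    have h3 : ∀ v, ∑ v', adjMat G v (u.succAbove v') * x (u.succAbove v')
        = l * x v - adjMat G v u * μ := by
      intro v
      have := hx v
      rw [Fin.sum_univ_succAbove _ u] at this
      linarith
    have h4 : ∑ v, ∑ v', adjMat G (u.succAbove v) (u.succAbove v')
        * (x (u.succAbove v) * x (u.succAbove v')) = l * (1 - 2 * μ ^ 2) := by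
      have h5 : ∀ v, ∑ v', adjMat G (u.succAbove v) (u.succAbove v')
          * (x (u.succAbove v) * x (u.succAbove v'))
          = l * x (u.succAbove v) ^ 2
            - adjMat G u (u.succAbove v) * x (u.succAbove v) * μ := by
        intro v
        have : ∑ v', adjMat G (u.succAbove v) (u.succAbove v')
            * (x (u.succAbove v) * x (u.succAbove v')) = x (u.succAbove v) *
            ∑ v', adjMat G (u.succAbove v) (u.succAbove v') * x (u.succAbove v') := by
          rw [Finset.mul_sum]
          exact Finset.sum_congr rfl fun v' _ => by ring
        rw [this, h3, adjMat_symm G (u.succAbove v) u]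
        ring
      rw [Finset.sum_congr rfl fun v _ => h5 v, Finset.sum_sub_distrib, ← Finset.mul_sum, h2,
        ← Finset.sum_mul, h3, adjMat_of_not_adj (G.irrefl)]
      ring
    rw [h4, h2] at h1
    exact h1
  have hnN : 32 ≤ ε ^ 2 * N := by
    rw [div_le_iff₀ (by positivity)] at hn
    have h1 : 0 ≤ ε ^ 2 := sq_nonneg ε
    calc (32 : ℝ) ≤ n * ε ^ 2 := hn
      _ ≤ ε ^ 2 * N := by rw [hN]; linarith
  exact deletion_bound hρ1 hε hε2 hμN hnN hkey hray

end deletion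

section perron_structure

variable {n r : ℕ}

lemma IsPerron.exists_normalized {V : Type*} [Fintype V] {G : SimpleGraph V} {l : ℝ}
    (h : IsPerron G l) : ∃ z : V → ℝ, (∀ v, 0 ≤ z v) ∧ ∑ v, z v = Fintype.card V ∧
      ∀ v, ∑ u, adjMat G v u * z u = l * z v := by
  obtain ⟨⟨x, hx0, hxs, hx⟩, -⟩ := h
  set t : ℝ := Fintype.card V / ∑ v, x v with ht
  have ht0 : 0 ≤ t := by positivity
  refine ⟨fun v => x v * t, fun v => mul_nonneg (hx0 v) ht0, ?_, fun v => ?_⟩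
  · rw [← Finset.sum_mul, ht, mul_div_cancel₀ _ hxs.ne']
  · simp only [← mul_assoc]
    rw [← Finset.sum_mul, hx v]

/-- The sum of `z` over a colour class. -/
noncomputable def clsSum {V : Type*} [Fintype V] (c : V → Fin r) (z : V → ℝ) (i : Fin r) : ℝ :=
  ∑ v, if c v = i then z v else 0

lemma sum_clsSum {V : Type*} [Fintype V] (c : V → Fin r) (z : V → ℝ) :
    ∑ i, clsSum c z i = ∑ v, z v := by
  unfold clsSum
  rw [Finset.sum_comm]
  simp

lemma quadratic_form_eq {V : Type*} [Fintype V] (G : SimpleGraph V) (c : V → Fin r)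
    (z : V → ℝ) :
    ∑ u, ∑ v, adjMat G u v * (z u * z v) = (∑ v, z v) ^ 2 - ∑ i, clsSum c z i ^ 2
      + ∑ u, ∑ v, inEdge G c u v * (z u * z v) - ∑ u, ∑ v, misEdge G c u v * (z u * z v) := by
  have h1 := sum_same c z z
  have h2 : ∀ u v, adjMat G u v * (z u * z v) = z u * z v - (if c u = c v then z u * z v else 0)
      + inEdge G c u v * (z u * z v) - misEdge G c u v * (z u * z v) := by
    intro u v
    rw [adjMat_eq G c]
    split_ifs <;> ring
  simp only [h2, Finset.sum_add_distrib, Finset.sum_sub_distrib]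
  rw [h1, pow_two (∑ v, z v), Finset.sum_mul_sum]
  simp only [clsSum, pow_two]

lemma sum_sq_sub_mean (hr : 0 < r) (S : Fin r → ℝ) :
    ∑ i, (S i - (∑ j, S j) / r) ^ 2 = ∑ i, S i ^ 2 - (∑ j, S j) ^ 2 / r := by
  have hr' : (r : ℝ) ≠ 0 := by positivity
  set T := ∑ j, S j with hT
  have h : ∀ i, (S i - T / r) ^ 2 = S i ^ 2 - 2 * (T / r) * S i + (T / r) ^ 2 := fun i => by ring
  simp only [h, Finset.sum_add_distrib, Finset.sum_sub_distrib, ← Finset.mul_sum, ← hT,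
    Finset.sum_const, Finset.card_univ, Fintype.card_fin, nsmul_eq_mul]
  field_simp
  ring

/-- A graph with large spectral radius that is close to being `r`-partite has an almost constant
Perron vector and is close to a complete balanced `r`-partite graph. -/
lemma perron_structure (hr : 2 ≤ r) {G : SimpleGraph (Fin n)} {l I₀ : ℝ} (hl : IsPerron G l)
    (c : Fin n → Fin r) (hI : ∑ u, ∑ v, inEdge G c u v ≤ I₀)
    (hlow : (1 - 1 / r) * (n : ℝ) - r / n ≤ l) (hn : 4 * r ≤ n) :
    (n : ℝ) / 4 ≤ l ∧ l ≤ (1 - 1 / r) * n + 16 * I₀ / n ∧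
    ∃ z : Fin n → ℝ, (∀ v, 0 ≤ z v) ∧ ∑ v, z v = n ∧
      (∀ v, ∑ u, adjMat G v u * z u = l * z v) ∧
      (∀ v, (z v - 1) ^ 2 ≤ 4 * (16 * I₀ + r) / n) ∧
      (∀ i, (clsSum c z i - n / r) ^ 2 ≤ 16 * I₀ + r) ∧
      ∑ u, ∑ v, misEdge G c u v * (z u * z v) ≤ 16 * I₀ + r := by
  have hr' : (2 : ℝ) ≤ r := by exact_mod_cast hr
  have hn' : (4 * r : ℝ) ≤ n := by exact_mod_cast hn
  have hn0 : (0 : ℝ) < n := by linarith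
  have hrho : (1 : ℝ) / r ≤ 1 / 2 := one_div_le_one_div_of_le (by norm_num) hr'
  have hrn : (r : ℝ) / n ≤ 1 / 4 := by rw [div_le_iff₀ hn0]; linarith
  have hl4 : (n : ℝ) / 4 ≤ l := by nlinarith
  have hl0 : 0 < l := by linarith
  obtain ⟨z, hz0, hz1, hz⟩ := hl.exists_normalized
  rw [Fintype.card_fin] at hz1
  have hz4 : ∀ v, z v ≤ 4 := by
    intro v
    have h1 : l * z v ≤ n := by
      rw [← hz v, ← hz1]
      exact Finset.sum_le_sum fun u _ => mul_le_of_le_one_left (hz0 u) (adjMat_le_one G v u)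
    nlinarith [hz0 v]
  have hin : ∑ u, ∑ v, inEdge G c u v * (z u * z v) ≤ 16 * I₀ := by
    refine le_trans ?_ (mul_le_mul_of_nonneg_left hI (by norm_num : (0 : ℝ) ≤ 16))
    rw [Finset.mul_sum]
    refine Finset.sum_le_sum fun u _ => ?_
    rw [Finset.mul_sum]
    refine Finset.sum_le_sum fun v _ => ?_
    rw [mul_comm]
    refine mul_le_mul_of_nonneg_right ?_ (inEdge_nonneg G c u v)
    nlinarith [hz0 u, hz0 v, hz4 u, hz4 v]
  have hq := quadratic_form_eq G c z
  have hq2 : ∑ u, ∑ v, adjMat G u v * (z u * z v) = l * ∑ v, z v ^ 2 := by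
    rw [Finset.mul_sum]
    refine Finset.sum_congr rfl fun u _ => ?_
    have : ∑ v, adjMat G u v * (z u * z v) = z u * ∑ v, adjMat G u v * z v := by
      rw [Finset.mul_sum]
      exact Finset.sum_congr rfl fun v _ => by ring
    rw [this, hz u]; ring
  have hS := sum_sq_sub_mean (by omega : 0 < r) (clsSum c z)
  rw [sum_clsSum, hz1] at hS
  have hR : ∑ v, (z v - 1) ^ 2 = ∑ v, z v ^ 2 - n := by
    have h : ∀ v, (z v - 1) ^ 2 = z v ^ 2 - 2 * z v + 1 := fun v => by ring
    simp only [h, Finset.sum_add_distrib, Finset.sum_sub_distrib, ← Finset.mul_sum, hz1]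
    simp
    ring
  have hR0 : 0 ≤ ∑ v, (z v - 1) ^ 2 := Finset.sum_nonneg fun v _ => sq_nonneg _
  have hS0 : 0 ≤ ∑ i, (clsSum c z i - n / r) ^ 2 := Finset.sum_nonneg fun v _ => sq_nonneg _
  have hM0 : 0 ≤ ∑ u, ∑ v, misEdge G c u v * (z u * z v) :=
    Finset.sum_nonneg fun u _ => Finset.sum_nonneg fun v _ =>
      mul_nonneg (misEdge_nonneg G c u v) (mul_nonneg (hz0 u) (hz0 v))
  set R := ∑ v, (z v - 1) ^ 2 with hRdef
  set D := ∑ i, (clsSum c z i - n / r) ^ 2 with hDdef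
  set M := ∑ u, ∑ v, misEdge G c u v * (z u * z v) with hMdef
  have hmain : l * (n + R) + D + M ≤ (1 - 1 / r) * n ^ 2 + 16 * I₀ := by
    rw [hq2, hz1] at hq
    have h1 : ∑ v, z v ^ 2 = n + R := by linarith
    rw [h1] at hq
    have h2 : (n : ℝ) ^ 2 / r = 1 / r * n ^ 2 := by ring
    rw [h2] at hS
    linarith
  have hlR : 0 ≤ l * R := mul_nonneg hl0.le hR0
  have hbound : l * R + D + M ≤ 16 * I₀ + r := by
    have h1 := mul_le_mul_of_nonneg_right hlow hn0.le
    have h2 : ((1 - 1 / r) * (n : ℝ) - r / n) * n = (1 - 1 / r) * n ^ 2 - r := by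
      field_simp
    linarith
  refine ⟨hl4, ?_, z, hz0, hz1, hz, fun v => ?_, fun i => ?_, by linarith⟩
  · have h1 : l * n ≤ (1 - 1 / r) * n ^ 2 + 16 * I₀ := by nlinarith
    have h2 : (1 - 1 / r) * (n : ℝ) + 16 * I₀ / n = ((1 - 1 / r) * n ^ 2 + 16 * I₀) / n := by
      field_simp
    rw [h2, le_div_iff₀ hn0]
    exact h1
  · have h1 : (z v - 1) ^ 2 ≤ R :=
      Finset.single_le_sum (f := fun v => (z v - 1) ^ 2) (fun v _ => sq_nonneg _)
        (Finset.mem_univ v)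
    rw [le_div_iff₀ hn0]
    nlinarith
  · have h1 : (clsSum c z i - n / r) ^ 2 ≤ D :=
      Finset.single_le_sum (f := fun i => (clsSum c z i - n / r) ^ 2) (fun v _ => sq_nonneg _)
        (Finset.mem_univ i)
    linarith

end perron_structure

section global_coloring

variable {r : ℕ} {W : Type*} {F : SimpleGraph W}

/-- An `F`-free graph with large spectral radius has an `r`-colouring with a bounded number of
monochromatic edges. -/
lemma exists_coloring_of_specRad {a : ℕ} (hr : 2 ≤ r) (h : HypStar r a F) :
    ∃ N : ℕ, ∀ n ≥ N, ∀ G : SimpleGraph (Fin n), FFree F G → ∀ l, IsPerron G l →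
      (1 - 1 / r) * (n : ℝ) - r / n ≤ l →
      ∃ c : Fin n → Fin r, ∑ u, ∑ v, inEdge G c u v ≤ 2 * r * a := by
  obtain ⟨ε, hε, hε8, N₁, hN₁⟩ := exists_coloring_of_minDegree hr h
  have hr' : (2 : ℝ) ≤ r := by exact_mod_cast hr
  set ρ : ℝ := 1 - 1 / r with hρ
  have hrho : (1 : ℝ) / r ≤ 1 / 2 := one_div_le_one_div_of_le (by norm_num) hr'
  have hrho0 : (0 : ℝ) ≤ 1 / r := by positivity
  have hρ2 : 1 / 2 ≤ ρ := by linarith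
  have hρ1 : ρ ≤ 1 := by linarith
  set κ : ℝ := ε ^ 2 / 32 with hκ
  have hκ0 : 0 < κ := by positivity
  obtain ⟨N₂, hN₂⟩ := exists_nat_ge (1 / κ + 64 * (r * a) / κ + 4 * r / κ + 2 * r / ε)
  set N₀ := N₁ + N₂ + 4 * r with hN₀
  have hbig : ∀ m : ℕ, N₂ ≤ m → 1 / κ ≤ m ∧ 64 * (r * a) / κ ≤ m ∧ 4 * r / κ ≤ m
      ∧ 2 * r / ε ≤ m := by
    intro m hm
    have h0 : (N₂ : ℝ) ≤ m := by exact_mod_cast hm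
    have h1 : 0 ≤ 1 / κ := by positivity
    have h2 : 0 ≤ 64 * (r * a) / κ := by positivity
    have h3 : 0 ≤ 4 * r / κ := by positivity
    have h4 : 0 ≤ 2 * r / ε := by positivity
    refine ⟨?_, ?_, ?_, ?_⟩ <;> linarith
  have hdel : ∀ m : ℕ, N₀ ≤ m → ∀ G : SimpleGraph (Fin (m + 1)), FFree F G → ∀ l, IsPerron G l →
      ρ * ((m + 1 : ℕ) : ℝ) - r / ((m + 1 : ℕ) : ℝ) ≤ l →
      (∃ c : Fin (m + 1) → Fin r, ∑ u, ∑ v, inEdge G c u v ≤ 2 * r * a) ∨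
      ∃ G' : SimpleGraph (Fin m), FFree F G' ∧ ∃ l', IsPerron G' l' ∧ l - ρ + κ ≤ l' := by
    intro m hm G hG l hl hlow
    obtain ⟨b1, b2, b3, b4⟩ := hbig m (by omega)
    by_cases hdeg : ∀ v, (1 - 1 / r - ε) * ((m + 1 : ℕ) : ℝ) ≤ ∑ u, adjMat G v u
    · exact Or.inl (hN₁ (m + 1) (by omega) G hG hdeg)
    · right
      push Not at hdeg
      obtain ⟨w, hw⟩ := hdeg
      have hm0 : (1 : ℝ) ≤ ((m + 1 : ℕ) : ℝ) := by push_cast; linarith [Nat.cast_nonneg (α := ℝ) m]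
      have hrm : (r : ℝ) / ((m + 1 : ℕ) : ℝ) ≤ ε / 2 * ((m + 1 : ℕ) : ℝ) := by
        rw [div_le_iff₀ (by linarith)]
        rw [div_le_iff₀ hε] at b4
        have h1 : (m : ℝ) ≤ ((m + 1 : ℕ) : ℝ) := by push_cast; linarith
        have h2 : 2 * r ≤ ((m + 1 : ℕ) : ℝ) * ε := b4.trans (mul_le_mul_of_nonneg_right h1 hε.le)
        nlinarith
      obtain ⟨u, hu⟩ := exists_deletion hρ2 hρ1 hε hl (by push_cast at *; linarith) (by linarith)
        (by rw [hκ, one_div_div] at b1; exact b1) w (by push_cast at hw; exact hw)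
      have : Nonempty (Fin m) := ⟨⟨0, by omega⟩⟩
      refine ⟨G.comap u.succAbove, hG.comap Fin.succAbove_right_injective, _,
        isPerron_specRad _, hu _ (isPerron_specRad _)⟩
  have hind : ∀ j : ℕ, ∀ G : SimpleGraph (Fin (N₀ + j)), FFree F G → ∀ l, IsPerron G l →
      l - ρ * ((N₀ + j : ℕ) : ℝ) ≤ max (N₀ - j * κ) (κ / 2) := by
    intro j
    induction j with
    | zero =>
      intro G hG l hl
      refine le_max_of_le_left ?_
      have h1 := hl.le_card
      rw [Fintype.card_fin] at h1
      have h2 : (0 : ℝ) ≤ ρ * ((N₀ + 0 : ℕ) : ℝ) := by positivity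
      push_cast at *
      linarith
    | succ j ih =>
      intro G hG l hl
      by_cases hneg : l - ρ * ((N₀ + (j + 1) : ℕ) : ℝ) ≤ 0
      · exact le_max_of_le_right (by linarith)
      have hpos : (0 : ℝ) ≤ r / ((N₀ + j + 1 : ℕ) : ℝ) := by positivity
      have hlow : ρ * ((N₀ + j + 1 : ℕ) : ℝ) - r / ((N₀ + j + 1 : ℕ) : ℝ) ≤ l := by
        rw [← add_assoc] at hneg
        linarith
      rcases hdel (N₀ + j) (by omega) G hG l hl hlow with ⟨c, hc⟩ | ⟨G', hG', l', hl', hle⟩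
      · refine le_max_of_le_right ?_
        obtain ⟨-, hup, -⟩ := perron_structure hr hl c hc hlow (by omega)
        obtain ⟨-, b2, -, -⟩ := hbig (N₀ + j + 1) (by omega)
        have h1 : 16 * (2 * r * a) / ((N₀ + j + 1 : ℕ) : ℝ) ≤ κ / 2 := by
          rw [div_le_iff₀ (by positivity)]
          rw [div_le_iff₀ hκ0] at b2
          linarith
        rw [← add_assoc, ← hρ] at hup
        rw [← add_assoc]
        linarith
      · have h1 := ih G' hG' l' hl'
        rcases le_max_iff.1 h1 with h2 | h2
        · refine le_max_of_le_left ?_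
          push_cast at *
          linarith
        · refine le_max_of_le_right ?_
          push_cast at *
          linarith
  obtain ⟨N₃, hN₃⟩ := exists_nat_ge ((N₀ : ℝ) / κ)
  refine ⟨N₀ + N₃ + 1, fun n hn G hG l hl hlow => ?_⟩
  obtain ⟨j, rfl⟩ : ∃ j, n = N₀ + j + 1 := ⟨n - N₀ - 1, by omega⟩
  rcases hdel (N₀ + j) (by omega) G hG l hl hlow with hc | ⟨G', hG', l', hl', hle⟩
  · exact hc
  exfalso
  have h1 := hind j G' hG' l' hl'
  have h2 : (N₀ : ℝ) - j * κ ≤ κ / 2 := by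
    rw [div_le_iff₀ hκ0] at hN₃
    have h3 : (N₃ : ℝ) ≤ j := by exact_mod_cast (by omega : N₃ ≤ j)
    nlinarith
  rw [max_eq_right h2] at h1
  obtain ⟨-, -, b3, -⟩ := hbig (N₀ + j + 1) (by omega)
  have h4 : (r : ℝ) / ((N₀ + j + 1 : ℕ) : ℝ) ≤ κ / 4 := by
    rw [div_le_iff₀ (by positivity)]
    rw [div_le_iff₀ hκ0] at b3
    linarith
  push_cast at *
  linarith

end global_coloring

section secular

variable {n r : ℕ}

lemma clsCard_eq_sum {V : Type*} [Fintype V] (c : V → Fin r) (i : Fin r) :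
    (clsCard c i : ℝ) = clsSum c (fun _ => 1) i := by
  simp [clsCard, clsSum]

lemma perron_limit (hr : 2 ≤ r) {I₀ δ : ℝ} (hI₀ : 0 ≤ I₀) (hδ : 0 < δ) (hδ2 : δ ≤ 1 / 2) :
    ∃ N : ℕ, ∀ n ≥ N, ∀ (G : SimpleGraph (Fin n)) (l : ℝ) (c : Fin n → Fin r), IsPerron G l →
      ∑ u, ∑ v, inEdge G c u v ≤ I₀ → (1 - 1 / r) * (n : ℝ) - r / n ≤ l →
      (n : ℝ) / 4 ≤ l ∧ (∀ i, |(clsCard c i : ℝ) - n / r| ≤ δ * n) ∧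
      (∀ i, |l + clsCard c i - n| ≤ δ * n) ∧
      ∑ u, ∑ v, misEdge G c u v ≤ 4 * (16 * I₀ + r) ∧
      ∃ z : Fin n → ℝ, ∑ v, z v = n ∧ (∀ v, ∑ u, adjMat G v u * z u = l * z v) ∧
        ∀ v, |z v - 1| ≤ δ := by
  have hr' : (2 : ℝ) ≤ r := by exact_mod_cast hr
  set C := 16 * I₀ + r with hC
  have hC0 : 0 < C := by positivity
  obtain ⟨N₁, hN₁⟩ := exists_nat_ge (64 * C / δ ^ 2)
  refine ⟨N₁ + 4 * r, fun n hn G l c hl hI hlow => ?_⟩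
  obtain ⟨h4, hup, z, hz0, hz1, hz, hzv, hzi, hM⟩ :=
    perron_structure hr hl c hI hlow (by omega)
  have hn1 : (N₁ : ℝ) ≤ n := by exact_mod_cast (by omega : N₁ ≤ n)
  have hn2 : (1 : ℝ) ≤ n := by exact_mod_cast (by omega : 1 ≤ n)
  have hn0 : (0 : ℝ) < n := by linarith
  have hbig : 64 * C ≤ n * δ ^ 2 := by
    have := hN₁.trans hn1
    rwa [div_le_iff₀ (by positivity)] at this
  have hz' : ∀ v, |z v - 1| ≤ δ / 4 := by
    intro v
    refine abs_le_of_sq_le_sq ?_ (by positivity)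
    refine (hzv v).trans ?_
    rw [div_le_iff₀ hn0]
    linarith
  have hS : ∀ i, |clsSum c z i - n / r| ≤ δ / 4 * n := by
    intro i
    refine abs_le_of_sq_le_sq ?_ (by positivity)
    refine (hzi i).trans ?_
    nlinarith
  have hSn : ∀ i, |clsSum c z i - clsCard c i| ≤ δ / 4 * n := by
    intro i
    rw [clsCard_eq_sum]
    unfold clsSum
    rw [← Finset.sum_sub_distrib]
    refine (Finset.abs_sum_le_sum_abs _ _).trans
      ((Finset.sum_le_card_nsmul _ _ (δ / 4) fun v _ => ?_).trans (le_of_eq ?_))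
    · split_ifs
      · exact hz' v
      · simp; positivity
    · rw [Finset.card_univ, Fintype.card_fin, nsmul_eq_mul, mul_comm]
  have hlc : |l - (1 - 1 / r) * n| ≤ δ / 4 * n := by
    have h1 : C / n ≤ δ / 4 * n := by
      rw [div_le_iff₀ hn0]
      nlinarith
    have h2 : 16 * I₀ / n ≤ C / n := by gcongr; linarith
    have h3 : r / n ≤ C / n := by gcongr; linarith
    rw [abs_le]
    constructor <;> linarith
  have hni : ∀ i, |(clsCard c i : ℝ) - n / r| ≤ δ / 2 * n := by
    intro i
    have h1 := abs_le.1 (hS i)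
    have h2 := abs_le.1 (hSn i)
    rw [abs_le]
    constructor <;> linarith
  refine ⟨h4, fun i => (hni i).trans (by nlinarith), fun i => ?_, ?_, z, hz1, hz,
    fun v => (hz' v).trans (by linarith)⟩
  · have h1 := abs_le.1 (hni i)
    have h2 := abs_le.1 hlc
    have h3 : (1 - 1 / (r : ℝ)) * n = n - n / r := by ring
    rw [h3] at h2
    have : 0 < δ * n := by positivity
    rw [abs_le]
    constructor <;> linarith
  · have h1 : ∑ u, ∑ v, misEdge G c u v ≤ 4 * ∑ u, ∑ v, misEdge G c u v * (z u * z v) := by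
      rw [Finset.mul_sum]
      refine Finset.sum_le_sum fun u _ => ?_
      rw [Finset.mul_sum]
      refine Finset.sum_le_sum fun v _ => ?_
      have h2 := abs_le.1 (hz' u)
      have h3 := abs_le.1 (hz' v)
      have h4 : 1 ≤ 4 * (z u * z v) := by nlinarith
      nlinarith [misEdge_nonneg G c u v]
    linarith

/-- The secular function of the complete multipartite graph with colour classes given by `c`. -/
noncomputable def secular {V : Type*} [Fintype V] (c : V → Fin r) (l : ℝ) : ℝ :=
  1 - ∑ i, (clsCard c i : ℝ) / (l + clsCard c i)

lemma secular_identity {G : SimpleGraph (Fin n)} {l : ℝ} (hl : 0 < l) (c : Fin n → Fin r)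
    {z : Fin n → ℝ} (hz1 : ∑ v, z v = n) (hz : ∀ v, ∑ u, adjMat G v u * z u = l * z v) :
    n ^ 2 * secular c l = ∑ v, ∑ u, (inEdge G c v u - misEdge G c v u)
      * (z u * (n / (l + clsCard c (c v)))) := by
  set D : Fin n → ℝ := fun v => ∑ u, (inEdge G c v u - misEdge G c v u) * z u with hD
  have hcls : ∀ i, (0 : ℝ) < l + clsCard c i := fun i => by positivity
  have h1 : ∀ v, l * z v = n - clsSum c z (c v) + D v := by
    intro v
    rw [← hz v, ← hz1]
    simp only [hD, clsSum]
    rw [← Finset.sum_sub_distrib, ← Finset.sum_add_distrib]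
    refine Finset.sum_congr rfl fun u _ => ?_
    rw [adjMat_eq G c]
    simp only [eq_comm (a := c v)]
    split_ifs <;> ring
  have h2 : ∀ i, clsSum c z i = n * (clsCard c i / (l + clsCard c i))
      + clsSum c D i / (l + clsCard c i) := by
    intro i
    have h3 : l * clsSum c z i = (n - clsSum c z i) * clsCard c i + clsSum c D i := by
      rw [clsCard_eq_sum]
      have hs : ∀ v, c v = i → l * z v = n - clsSum c z i + D v := fun v hv => hv ▸ h1 v
      generalize (n : ℝ) - clsSum c z i = s at hs
      unfold clsSum
      rw [Finset.mul_sum, Finset.mul_sum, ← Finset.sum_add_distrib]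
      refine Finset.sum_congr rfl fun v _ => ?_
      split_ifs with h
      · rw [hs v h]; ring
      · simp
    have h4 := (hcls i).ne'
    field_simp
    linarith
  have h5 : n * secular c l = ∑ i, clsSum c D i / (l + clsCard c i) := by
    have h6 := sum_clsSum c z
    rw [hz1, Finset.sum_congr rfl fun i _ => h2 i, Finset.sum_add_distrib, ← Finset.mul_sum] at h6
    unfold secular
    linarith
  have h7 : ∑ i, clsSum c D i / (l + clsCard c i) = ∑ v, D v / (l + clsCard c (c v)) := by
    unfold clsSum
    simp only [Finset.sum_div]
    rw [Finset.sum_comm]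
    refine Finset.sum_congr rfl fun v _ => ?_
    rw [Finset.sum_eq_single (c v)]
    · simp
    · intro i _ hi
      rw [if_neg hi.symm, zero_div]
    · simp
  rw [pow_two, mul_assoc, h5, h7, Finset.mul_sum]
  refine Finset.sum_congr rfl fun v _ => ?_
  simp only [hD, Finset.sum_div, Finset.mul_sum]
  exact Finset.sum_congr rfl fun u _ => by ring

/-- The secular function at the spectral radius measures the surplus of edges. -/
lemma secular_approx (hr : 2 ≤ r) {I₀ η : ℝ} (hI₀ : 0 ≤ I₀) (hη : 0 < η) :
    ∃ N : ℕ, ∀ n ≥ N, ∀ (G : SimpleGraph (Fin n)) (l : ℝ) (c : Fin n → Fin r), IsPerron G l →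
      ∑ u, ∑ v, inEdge G c u v ≤ I₀ → (1 - 1 / r) * (n : ℝ) - r / n ≤ l →
      (n : ℝ) / 4 ≤ l ∧ (∀ i, (n : ℝ) / (2 * r) ≤ clsCard c i) ∧
      ∑ u, ∑ v, misEdge G c u v ≤ 4 * (16 * I₀ + r) ∧
      |n ^ 2 * secular c l - (∑ u, ∑ v, inEdge G c u v - ∑ u, ∑ v, misEdge G c u v)| ≤ η := by
  have hr' : (2 : ℝ) ≤ r := by exact_mod_cast hr
  set K : ℝ := I₀ + 4 * (16 * I₀ + r) with hK
  have hK0 : 0 < K := by positivity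
  set δ : ℝ := min (1 / (2 * r)) (η / (4 * K)) with hδ
  have hδ0 : 0 < δ := lt_min (by positivity) (by positivity)
  have hδr : δ ≤ 1 / (2 * r) := min_le_left _ _
  have hδ4 : δ ≤ 1 / 4 := hδr.trans (one_div_le_one_div_of_le (by norm_num) (by linarith))
  have hδK : 4 * δ * K ≤ η := by
    have := min_le_right (1 / (2 * (r : ℝ))) (η / (4 * K))
    rw [← hδ, le_div_iff₀ (by positivity)] at this
    linarith
  obtain ⟨N, hN⟩ := perron_limit hr hI₀ hδ0 (by linarith)
  refine ⟨N + 1, fun n hn G l c hl hI hlow => ?_⟩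
  have hn0 : (0 : ℝ) < n := by exact_mod_cast (by omega : 0 < n)
  obtain ⟨h4, hni, hln, hJ, z, hz1, hz, hzv⟩ := hN n (by omega) G l c hl hI hlow
  refine ⟨h4, fun i => ?_, hJ, ?_⟩
  · have h1 := (abs_le.1 (hni i)).1
    have h2 : δ * n ≤ 1 / (2 * r) * n := mul_le_mul_of_nonneg_right hδr hn0.le
    have h3 : 1 / (2 * (r : ℝ)) * n = n / (2 * r) := by ring
    have h5 : (n : ℝ) / r = n / (2 * r) + n / (2 * r) := by field_simp; norm_num
    linarith
  · rw [secular_identity (by linarith) c hz1 hz, ← Finset.sum_sub_distrib, ← Finset.sum_sub_distrib]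
    have hterm : ∀ v u, |(inEdge G c v u - misEdge G c v u) * (z u * (n / (l + clsCard c (c v))))
        - (inEdge G c v u - misEdge G c v u)| ≤ (inEdge G c v u + misEdge G c v u) * (4 * δ) := by
      intro v u
      have h1 : (inEdge G c v u - misEdge G c v u) * (z u * (n / (l + clsCard c (c v))))
          - (inEdge G c v u - misEdge G c v u) = (inEdge G c v u - misEdge G c v u)
            * (z u * (n / (l + clsCard c (c v))) - 1) := by ring
      rw [h1, abs_mul]
      refine mul_le_mul ?_ ?_ (abs_nonneg _)
        (add_nonneg (inEdge_nonneg _ _ _ _) (misEdge_nonneg _ _ _ _))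
      · rw [abs_le]
        constructor <;> linarith [inEdge_nonneg G c v u, misEdge_nonneg G c v u]
      · have h2 := abs_le.1 (hln (c v))
        have h3 := abs_le.1 (hzv u)
        set b := l + (clsCard c (c v) : ℝ) with hb
        have hδn : δ * n ≤ 1 / 4 * n := mul_le_mul_of_nonneg_right hδ4 hn0.le
        have hb0 : 0 < b := by linarith
        have h5 : z u * (n / b) - 1 = (z u * n - b) / b := by field_simp
        rw [h5, abs_div, abs_of_pos hb0, div_le_iff₀ hb0, abs_le]
        constructor <;> nlinarith
    have habs : |∑ v, (∑ u, (inEdge G c v u - misEdge G c v u)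
          * (z u * (n / (l + clsCard c (c v))))
          - (∑ u, inEdge G c v u - ∑ u, misEdge G c v u))|
        ≤ ∑ v, ∑ u, (inEdge G c v u + misEdge G c v u) * (4 * δ) := by
      refine (Finset.abs_sum_le_sum_abs _ _).trans (Finset.sum_le_sum fun v _ => ?_)
      rw [← Finset.sum_sub_distrib, ← Finset.sum_sub_distrib]
      exact (Finset.abs_sum_le_sum_abs _ _).trans (Finset.sum_le_sum fun u _ => hterm v u)
    refine habs.trans ?_
    simp only [← Finset.sum_mul, Finset.sum_add_distrib]
    have : (∑ v, ∑ u, inEdge G c v u + ∑ v, ∑ u, misEdge G c v u) * (4 * δ) ≤ K * (4 * δ) :=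
      mul_le_mul_of_nonneg_right (by linarith) (by positivity)
    linarith

end secular

section final

variable {n r : ℕ} {W : Type*} {F : SimpleGraph W}

lemma secular_mono {V : Type*} [Fintype V] (c : V → Fin r) {l l' : ℝ} (hl : 0 < l)
    (hll : l ≤ l') : secular c l ≤ secular c l' := by
  unfold secular
  refine sub_le_sub_left (Finset.sum_le_sum fun i _ => ?_) 1
  exact div_le_div_of_nonneg_left (by positivity) (by positivity) (by linarith)

lemma chord_sub_eq {l k q : ℝ} (hl : 0 < l) (hk : 0 ≤ k) (hq : 0 ≤ q) :
    q / (l + q) + (k - q) * ((q + 1) / (l + (q + 1)) - q / (l + q)) - k / (l + k)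
      = l * ((k - q) * (k - q - 1)) / ((l + k) * (l + q) * (l + (q + 1))) := by
  have h1 : l + q ≠ 0 := by positivity
  have h2 : l + (q + 1) ≠ 0 := by positivity
  have h3 : l + k ≠ 0 := by positivity
  field_simp
  ring

lemma clsCard_le (c : Fin n → Fin r) (i : Fin r) : clsCard c i ≤ n := by
  have := Finset.card_le_univ (Finset.univ.filter fun v => c v = i)
  rwa [Fintype.card_fin] at this

/-- Among all colourings the balanced ones minimise the secular function. -/
lemma secular_equi_le {c c' : Fin n → Fin r} (hc : EquiColoring c) {l : ℝ} (hl : 0 < l) :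
    secular c l ≤ secular c' l ∧
      (¬ EquiColoring c' → (n : ℝ) / 4 ≤ l → l ≤ n → 1 ≤ n → 2 ≤ r →
        n ^ 2 * secular c l + 1 / 16 ≤ n ^ 2 * secular c' l) := by
  set q := n / r with hq
  set g : ℝ → ℝ := fun k => k / (l + k) with hg
  set L : ℝ → ℝ := fun k => g q + (k - q) * (g (q + 1) - g q) with hL
  have hLsum : ∀ d : Fin n → Fin r, ∑ i, L (clsCard d i) = r * g q
      + (n - r * q) * (g (q + 1) - g q) := by
    intro d
    have h1 : ∑ i, (clsCard d i : ℝ) = n := by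
      have := sum_clsCard d
      rw [Fintype.card_fin] at this
      exact_mod_cast this
    simp only [hL, Finset.sum_add_distrib, ← Finset.sum_mul, Finset.sum_sub_distrib, h1]
    simp
  have hequi : ∀ i, g (clsCard c i) = L (clsCard c i) := by
    intro i
    rcases hc i with h | h <;> rw [h] <;> simp [hL, ← hq]
  have hgap : ∀ k : ℕ, L k - g k = l * (((k : ℝ) - q) * (k - q - 1))
      / ((l + k) * (l + q) * (l + (q + 1))) := fun k =>
    chord_sub_eq hl (Nat.cast_nonneg k) (Nat.cast_nonneg q)
  have hprod : ∀ k : ℕ, 0 ≤ ((k : ℝ) - q) * (k - q - 1) := by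
    intro k
    rcases le_or_gt k q with h | h
    · have : (k : ℝ) ≤ q := by exact_mod_cast h
      nlinarith
    · have : (q + 1 : ℝ) ≤ k := by exact_mod_cast h
      nlinarith
  have hnonneg : ∀ k : ℕ, 0 ≤ L k - g k := by
    intro k
    rw [hgap]
    have := hprod k
    positivity
  have hdiff : secular c' l - secular c l = ∑ i, (L (clsCard c' i) - g (clsCard c' i)) := by
    have h1 : ∑ i, g (clsCard c i) = ∑ i, L (clsCard c i) :=
      Finset.sum_congr rfl fun i _ => hequi i
    rw [Finset.sum_sub_distrib, hLsum c', ← hLsum c, ← h1]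
    simp only [secular, hg]
    ring
  refine ⟨?_, fun hne h4 hln hn hr => ?_⟩
  · have := Finset.sum_nonneg fun i (_ : i ∈ Finset.univ) => hnonneg (clsCard c' i)
    linarith
  · unfold EquiColoring at hne
    push Not at hne
    obtain ⟨i, hi1, hi2⟩ := hne
    have h1 : L (clsCard c' i) - g (clsCard c' i) ≤ secular c' l - secular c l := by
      rw [hdiff]
      exact Finset.single_le_sum (f := fun i => L (clsCard c' i) - g (clsCard c' i))
        (fun i _ => hnonneg _) (Finset.mem_univ i)
    have hn0 : (1 : ℝ) ≤ n := by exact_mod_cast hn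
    have hkn : (clsCard c' i : ℝ) ≤ n := by exact_mod_cast clsCard_le c' i
    have hqn : (q + 1 : ℝ) ≤ n := by
      have : q < n := Nat.div_lt_self (by omega) (by omega)
      exact_mod_cast this
    have hprod : 2 ≤ ((clsCard c' i : ℝ) - q) * (clsCard c' i - q - 1) := by
      rcases lt_or_gt_of_ne hi1 with h | h
      · have : (clsCard c' i : ℝ) + 1 ≤ q := by exact_mod_cast h
        nlinarith
      · have h' : q + 2 ≤ clsCard c' i := by omega
        have : (q + 2 : ℝ) ≤ clsCard c' i := by exact_mod_cast h'
        nlinarith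
    have hden : (l + clsCard c' i) * (l + q) * (l + (q + 1)) ≤ (2 * n) * (2 * n) * (2 * n) := by
      gcongr <;> linarith
    have hlow : 1 / (16 * (n : ℝ) ^ 2) ≤ L (clsCard c' i) - g (clsCard c' i) := by
      rw [hgap]
      calc 1 / (16 * (n : ℝ) ^ 2) = n / 4 * 2 / ((2 * n) * (2 * n) * (2 * n)) := by
            field_simp; norm_num
        _ ≤ _ := by gcongr
    have h2 := mul_le_mul_of_nonneg_left (hlow.trans h1) (sq_nonneg (n : ℝ))
    have h3 : (n : ℝ) ^ 2 * (1 / (16 * n ^ 2)) = 1 / 16 := by field_simp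
    rw [h3] at h2
    linarith

/-- If the defects of an `F`-free graph with respect to a colouring are bounded, then there are at
most `a` more monochromatic edges than missing bichromatic edges. -/
lemma excess_le_of_bounded {a m₀ K : ℕ} (hr : 0 < r)
    (hex : ∀ m ≥ m₀, exNum m F ≤ eCnt (turanGraph m r) + a)
    {G : SimpleGraph (Fin n)} (hG : FFree F G) (c : Fin n → Fin r)
    (hK : ∑ u, ∑ v, inEdge G c u v + ∑ u, ∑ v, misEdge G c u v ≤ K)
    (hcls : ∀ i, m₀ + K ≤ clsCard c i) :
    ∑ u, ∑ v, inEdge G c u v - ∑ u, ∑ v, misEdge G c u v ≤ 2 * a := by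
  classical
  set w : Fin n → Fin n → ℝ := fun u v => inEdge G c u v + misEdge G c u v with hw
  have hw0 : ∀ u v, 0 ≤ w u v := fun u v =>
    add_nonneg (inEdge_nonneg _ _ _ _) (misEdge_nonneg _ _ _ _)
  have hw1 : ∀ u v, w u v ≠ 0 → 1 ≤ w u v := by
    intro u v
    simp only [hw, inEdge, misEdge]
    by_cases h : G.Adj u v
    · rw [adjMat_of_adj h]; split_ifs <;> simp
    · rw [adjMat_of_not_adj h]; split_ifs <;> simp
  set U : Finset (Fin n) := Finset.univ.filter fun u => ∃ v, w u v ≠ 0 with hU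
  have hUc : U.card ≤ K := by
    have h1 : (U.card : ℝ) ≤ ∑ u, ∑ v, w u v := by
      have h2 : (U.card : ℝ) = ∑ u ∈ U, (1 : ℝ) := by simp
      rw [h2]
      refine (Finset.sum_le_sum fun u hu => ?_).trans
        (Finset.sum_le_sum_of_subset_of_nonneg (Finset.subset_univ U) fun u _ _ =>
          Finset.sum_nonneg fun v _ => hw0 u v)
      obtain ⟨v, hv⟩ := (Finset.mem_filter.1 hu).2
      exact (hw1 u v hv).trans
        (Finset.single_le_sum (f := fun v => w u v) (fun v _ => hw0 u v) (Finset.mem_univ v))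
    simp only [hw, Finset.sum_add_distrib] at h1
    exact_mod_cast h1.trans hK
  have hP : ∀ i, ∃ P : Finset (Fin n), (U.filter fun v => c v = i) ⊆ P ∧
      P ⊆ Finset.univ.filter (fun v => c v = i) ∧ P.card = m₀ + K := fun i =>
    Finset.exists_subsuperset_card_eq
      (Finset.filter_subset_filter _ (Finset.subset_univ U))
      ((Finset.card_filter_le _ _).trans (by omega)) (hcls i)
  choose P hP1 hP2 hP3 using hP
  set Q := Finset.univ.biUnion P with hQ
  have hfil : ∀ i, (Q.filter fun v => c v = i) = P i := by
    intro i
    ext x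
    simp only [hQ, Finset.mem_filter, Finset.mem_biUnion, Finset.mem_univ, true_and]
    constructor
    · rintro ⟨⟨j, hj⟩, hx⟩
      have hcj : c x = j := by simpa using hP2 j hj
      rw [← hx, hcj]; exact hj
    · exact fun hx => ⟨⟨i, hx⟩, by simpa using hP2 i hx⟩
  have hUQ : U ⊆ Q := fun x hx => Finset.mem_biUnion.2
    ⟨c x, Finset.mem_univ _, hP1 (c x) (Finset.mem_filter.2 ⟨hx, rfl⟩)⟩
  have hzero : ∀ u v, u ∉ Q ∨ v ∉ Q → inEdge G c u v = 0 ∧ misEdge G c u v = 0 := by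
    intro u v huv
    have h1 : w u v = 0 := by
      by_contra hne
      rcases huv with h | h
      · exact h (hUQ (Finset.mem_filter.2 ⟨Finset.mem_univ _, v, hne⟩))
      · refine h (hUQ (Finset.mem_filter.2 ⟨Finset.mem_univ _, u, ?_⟩))
        simp only [hw] at hne ⊢
        rwa [inEdge_symm, misEdge_symm]
    simp only [hw] at h1
    constructor <;> linarith [inEdge_nonneg G c u v, misEdge_nonneg G c u v]
  have hres : ∀ f : Fin n → Fin n → ℝ, (∀ u v, u ∉ Q ∨ v ∉ Q → f u v = 0) →
      ∑ u ∈ Q, ∑ v ∈ Q, f u v = ∑ u, ∑ v, f u v := by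
    intro f hf
    rw [← Finset.sum_subset (Finset.subset_univ Q) fun u _ hu =>
      Finset.sum_eq_zero fun v _ => hf u v (Or.inl hu)]
    exact Finset.sum_congr rfl fun u _ =>
      Finset.sum_subset (Finset.subset_univ Q) fun v _ hv => hf u v (Or.inr hv)
  have h := excess_le hr (hex (r * (m₀ + K)) (by nlinarith)) hG c Q
    (fun i => by rw [hfil, hP3])
  rwa [hres _ fun u v h => (hzero u v h).1, hres _ fun u v h => (hzero u v h).2] at h

lemma EquiColoring.sub_eq (hr : 0 < r) {c : Fin n → Fin r} (hc : EquiColoring c)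
    (G : SimpleGraph (Fin n)) :
    ∑ u, ∑ v, inEdge G c u v - ∑ u, ∑ v, misEdge G c u v
      = 2 * (eCnt G : ℝ) - 2 * eCnt (turanGraph n r) := by
  have h1 := two_mul_eCnt G c
  have h2 := hc.two_mul_eCnt_turanGraph hr
  rw [Fintype.card_fin] at h1
  linarith

lemma two_mul_eCnt_turanGraph_ge (hr : 0 < r) :
    (1 - 1 / r) * (n : ℝ) ^ 2 - r ≤ 2 * eCnt (turanGraph n r) := by
  have hr' : (0 : ℝ) < r := by exact_mod_cast hr
  have hc := modColor_equi n hr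
  rw [hc.two_mul_eCnt_turanGraph hr]
  have h1 := sum_sq_sub_mean hr fun i => (clsCard (modColor n r hr) i : ℝ)
  have h2 : ∑ i, (clsCard (modColor n r hr) i : ℝ) = n := by
    have := sum_clsCard (modColor n r hr)
    rw [Fintype.card_fin] at this
    exact_mod_cast this
  rw [h2] at h1
  have h3 : ∑ i, ((clsCard (modColor n r hr) i : ℝ) - n / r) ^ 2 ≤ r := by
    refine (Finset.sum_le_card_nsmul _ _ 1 fun i _ => ?_).trans (by simp)
    have hq1 : ((n / r : ℕ) : ℝ) ≤ n / r := Nat.cast_div_le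
    have hq2 : (n : ℝ) / r < ((n / r : ℕ) : ℝ) + 1 := by
      rw [div_lt_iff₀ hr']
      exact_mod_cast Nat.lt_mul_of_div_lt (Nat.lt_succ_self (n / r)) hr
    rcases hc i with h | h <;> rw [h] <;> push_cast <;> nlinarith
  have h4 : (1 - 1 / (r : ℝ)) * n ^ 2 = n ^ 2 - n ^ 2 / r := by ring
  linarith

lemma TuranPlus.exists_coloring {a : ℕ} (hr : 0 < r) {K : SimpleGraph (Fin n)}
    (h : TuranPlus n r a K) : ∃ c : Fin n → Fin r, EquiColoring c ∧
      ∀ u v, misEdge K c u v = 0 := by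
  obtain ⟨⟨H, hHK, ⟨φ⟩⟩, -⟩ := h
  refine ⟨fun v => modColor n r hr (φ v), fun i => ?_, fun u v => ?_⟩
  · have h1 : clsCard (fun v => modColor n r hr (φ v)) i = clsCard (modColor n r hr) i := by
      unfold clsCard
      refine Finset.card_bij (fun v _ => φ v) (fun v hv => by simpa using hv)
        (fun u _ v _ huv => φ.injective huv) fun v hv => ?_
      obtain ⟨u, rfl⟩ := φ.surjective v
      exact ⟨u, by simpa using hv, rfl⟩
    rw [h1]
    exact modColor_equi n hr i
  · unfold misEdge
    split_ifs with huv
    · rfl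
    · rw [adjMat_of_adj, sub_self]
      refine hHK (φ.map_adj_iff.1 ?_)
      rw [turanGraph_adj]
      intro heq
      exact huv (Fin.ext heq)

end final

theorem stmt_0 {W : Type*} (r a : ℕ) (hr : 2 ≤ r) (F : SimpleGraph W) (h : HypStar r a F) :
    ∃ n₀ : ℕ, ∀ n ≥ n₀, ∀ G : SimpleGraph (Fin n), SpecExtremal F G →
      eCnt G = exNum n F ∧ TuranPlus n r a G := by
  have hr0 : 0 < r := by omega
  have hr' : (2 : ℝ) ≤ r := by exact_mod_cast hr
  obtain ⟨N₁, hN₁⟩ := exists_coloring_of_specRad hr h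
  obtain ⟨m₀, hm₀⟩ := h
  obtain ⟨N₂, hN₂⟩ := secular_approx hr (I₀ := 2 * r * a) (η := 1 / 64) (by positivity)
    (by norm_num)
  set K := 2 * r * a + 4 * (16 * (2 * r * a) + r) with hK
  refine ⟨m₀ + N₁ + N₂ + 2 * r * (m₀ + K) + 4 * r, fun n hn G ⟨hG, hmax⟩ => ?_⟩
  have hnr : 4 * r ≤ n := by omega
  have hnK : 2 * r * (m₀ + K) ≤ n := by omega
  have hn0 : (0 : ℝ) < n := by exact_mod_cast (by omega : 0 < n)
  have : Nonempty (Fin n) := ⟨⟨0, by omega⟩⟩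
  obtain ⟨hex, hstar⟩ := hm₀ n (by omega)
  suffices hle : exNum n F ≤ eCnt G by
    have heq := le_antisymm hG.eCnt_le hle
    exact ⟨heq, hstar G hG heq⟩
  rw [hex]
  have hT := two_mul_eCnt_turanGraph_ge (n := n) hr0
  have hrho : (1 : ℝ) / r ≤ 1 / 2 := one_div_le_one_div_of_le (by norm_num) hr'
  have hpos : exNum n F ≠ 0 := by
    intro h0
    have h1 : (eCnt (turanGraph n r) : ℝ) = 0 := by
      exact_mod_cast (by omega : eCnt (turanGraph n r) = 0)
    have h2 : (4 * r : ℝ) ≤ n := by exact_mod_cast hnr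
    rw [h1] at hT
    nlinarith
  obtain ⟨H, hH, hHe⟩ := exists_extremal hpos
  obtain ⟨cH, hcH, hmis⟩ := (hstar H hH hHe).exists_coloring hr0
  have hPH := isPerron_specRad H
  have hPG := isPerron_specRad G
  have hlH : (1 - 1 / r) * (n : ℝ) - r / n ≤ specRad H := by
    have h1 := hPH.2 fun _ => 1
    simp only [mul_one, one_pow, sum_adjMat] at h1
    simp only [Finset.sum_const, Finset.card_univ, Fintype.card_fin, nsmul_eq_mul, mul_one] at h1
    have h2 : (eCnt (turanGraph n r) : ℝ) ≤ eCnt H := by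
      exact_mod_cast (by omega : eCnt (turanGraph n r) ≤ eCnt H)
    have h3 : ((1 - 1 / r) * (n : ℝ) - r / n) * n = (1 - 1 / r) * n ^ 2 - r := by field_simp
    refine le_of_mul_le_mul_right ?_ hn0
    linarith
  have hHG := hmax H hH
  have hlG := hlH.trans hHG
  have hHsub := hcH.sub_eq hr0 H
  have hHe' : (eCnt H : ℝ) = eCnt (turanGraph n r) + a := by
    exact_mod_cast hHe.trans hex
  have hHmis : ∑ u, ∑ v, misEdge H cH u v = 0 :=
    Finset.sum_eq_zero fun u _ => Finset.sum_eq_zero fun v _ => hmis u v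
  have hHin : ∑ u, ∑ v, inEdge H cH u v ≤ 2 * r * a := by
    have : (0 : ℝ) ≤ a := by positivity
    nlinarith
  obtain ⟨h4H, -, -, hHapp⟩ := hN₂ n (by omega) H _ cH hPH hHin hlH
  obtain ⟨c, hc⟩ := hN₁ n (by omega) G hG _ hPG hlG
  obtain ⟨h4G, hcls, hJ, hGapp⟩ := hN₂ n (by omega) G _ c hPG hc hlG
  have hlH0 : 0 < specRad H := by linarith
  have hlG0 : 0 < specRad G := by linarith
  have hlGn : specRad G ≤ n := by simpa using hPG.le_card
  have hmono := mul_le_mul_of_nonneg_left (secular_mono cH hlH0 hHG) (sq_nonneg (n : ℝ))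
  obtain ⟨hequi, hgap⟩ := secular_equi_le (c' := c) hcH hlG0
  have hequi' := mul_le_mul_of_nonneg_left hequi (sq_nonneg (n : ℝ))
  have h5 := (abs_le.1 hHapp).1
  have h6 := (abs_le.1 hGapp).2
  have hexc : ∑ u, ∑ v, inEdge G c u v - ∑ u, ∑ v, misEdge G c u v ≤ 2 * a := by
    refine excess_le_of_bounded (m₀ := m₀) (K := K) hr0 (fun m hm => (hm₀ m hm).1.le) hG c ?_ ?_
    · rw [hK]; push_cast; linarith
    · intro i
      have h7 : (2 * r * (m₀ + K) : ℝ) ≤ n := by exact_mod_cast hnK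
      have h8 : ((m₀ + K : ℕ) : ℝ) ≤ n / (2 * r) := by
        rw [le_div_iff₀ (by positivity)]; push_cast; linarith
      exact_mod_cast h8.trans (hcls i)
  by_cases hce : EquiColoring c
  · by_contra! hlt
    have h9 := hce.sub_eq hr0 G
    have h10 : (eCnt G : ℝ) + 1 ≤ eCnt (turanGraph n r) + a := by exact_mod_cast hlt
    linarith
  · have := hgap hce h4G hlGn (by omega) hr
    linarith
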